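/- arXiv:2312.04360 — 5 statements merged into one kernel-verified Lean document; each statement's English description precedes it below -/
import Mathlib

section
/- For all positive integers n and k there exists a probability distribution on {−1,1}^n that is k-wise uniform and whose support has size at most (2·max(n,2))^k. -/
open Finset

/-- Evaluating the polynomials of degree less than `k`, given by their coefficient vectors,
at `k` distinct points of a finite field is a bijection. -/
lemma vandermonde_mulVec_bijective {F : Type*} [Field F] [Finite F] {k : ℕ} {v : Fin k → F}
    (hv : Function.Injective v) : Function.Bijective (Matrix.vandermonde v).mulVec := by
  refine Finite.injective_iff_bijective.1 (Matrix.mulVec_injective_iff_isUnit.2 ?_)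
  rw [Matrix.isUnit_iff_isUnit_det, isUnit_iff_ne_zero]
  exact Matrix.det_vandermonde_ne_zero_iff.2 hv

/-- If every fibre of `b : F → Bool` has `h` elements, then exactly `h ^ k` coefficient vectors
give polynomials whose values at `k` distinct points are mapped by `b` to prescribed bits. -/
lemma card_filter_vandermonde_mulVec {F : Type*} [Field F] [Fintype F] {k h : ℕ}
    {b : F → Bool} (hb : ∀ t, #{a | b a = t} = h) {v : Fin k → F}
    (hv : Function.Injective v) (y : Fin k → Bool) :
    #{c : Fin k → F | ∀ j, b ((Matrix.vandermonde v).mulVec c j) = y j} = h ^ k := by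
  classical
  calc #{c : Fin k → F | ∀ j, b ((Matrix.vandermonde v).mulVec c j) = y j}
      = #(Fintype.piFinset fun j => ({a | b a = y j} : Finset F)) :=
        card_bijective _ (vandermonde_mulVec_bijective hv) fun c => by simp
    _ = h ^ k := by simp [hb]

/-- A finite type with `2 * h` elements admits a map to `Bool` with fibres of size `h`. -/
lemma exists_balanced_bool {F : Type*} [Fintype F] {h : ℕ} (hF : Fintype.card F = 2 * h) :
    ∃ b : F → Bool, ∀ t, #{a | b a = t} = h := by
  classical
  have e : F ≃ Bool × Fin h := Fintype.equivOfCardEq (by simp [hF])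
  refine ⟨fun a => (e a).1, fun t => ?_⟩
  calc #{a | (e a).1 = t} = #(({t} : Finset Bool) ×ˢ (univ : Finset (Fin h))) :=
        card_bijective e e.bijective fun a => by
          simp only [mem_filter, mem_product, mem_singleton, mem_univ, true_and, and_true]
    _ = h := by simp

/-- The weights of the image under `g` of the uniform distribution on `C`, summed over `S`. -/
lemma sum_card_fiber_div {C Z : Type*} [Fintype C] [DecidableEq Z] (g : C → Z) (S : Finset Z) :
    ∑ z ∈ S, (#{c | g c = z} : ℝ) / Fintype.card C = (#{c | g c ∈ S} : ℝ) / Fintype.card C := by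
  rw [← sum_div, card_eq_sum_card_fiberwise (f := g) (t := S) (by intro c; simp)]
  push_cast
  congr 1
  refine sum_congr rfl fun z hz => ?_
  congr 2
  ext c
  simp only [mem_filter, mem_univ, true_and]
  exact ⟨fun h => ⟨h ▸ hz, h⟩, And.right⟩

/-- There is a finite field whose number of elements is even, at least `N` and at most `2 * N`. -/
lemma exists_field_card_even {N : ℕ} (hN : 2 ≤ N) :
    ∃ (F : Type) (_ : Field F) (_ : Fintype F) (h : ℕ),
      Fintype.card F = 2 * h ∧ N ≤ 2 * h ∧ h ≤ N := by
  have : Fact (Nat.Prime 2) := ⟨Nat.prime_two⟩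
  have hm : 0 < Nat.clog 2 N := Nat.clog_pos one_lt_two hN
  have hpow : 2 ^ Nat.clog 2 N = 2 * 2 ^ (Nat.clog 2 N - 1) := (mul_pow_sub_one hm.ne' 2).symm
  let _ := Fintype.ofFinite (GaloisField 2 (Nat.clog 2 N))
  refine ⟨GaloisField 2 (Nat.clog 2 N), inferInstance, inferInstance,
    2 ^ (Nat.clog 2 N - 1), ?_, ?_, ?_⟩
  · rw [← Nat.card_eq_fintype_card, GaloisField.card 2 _ hm.ne', hpow]
  · exact hpow ▸ Nat.le_pow_clog one_lt_two N
  · exact (Nat.pow_pred_clog_lt_self one_lt_two hN).le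

/-- for all positive integers `n` and `k` there is a probability
distribution on `{−1,1}ⁿ` (encoded via `Bool`, given by its weight function `w`) that
is `k`-wise uniform and whose support has size at most `(2·max(n,2))^k`. -/
theorem stmt8 (n k : ℕ) (hn : 0 < n) (hk : 0 < k) :
    ∃ w : (Fin n → Bool) → ℝ,
      (∀ z, 0 ≤ w z) ∧ (∑ z : Fin n → Bool, w z = 1) ∧
      (∀ x : Fin k → Fin n, Function.Injective x → ∀ y : Fin k → Bool,
        (∑ z ∈ Finset.univ.filter fun z : Fin n → Bool => ∀ j, z (x j) = y j, w z)
          = 1 / 2 ^ k) ∧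
      (Finset.univ.filter fun z : Fin n → Bool => w z ≠ 0).card ≤ (2 * max n 2) ^ k := by
  classical
  obtain ⟨F, _, _, h, hF, hle, hge⟩ := exists_field_card_even (le_max_right n 2)
  obtain ⟨b, hb⟩ := exists_balanced_bool hF
  obtain ⟨a⟩ : Nonempty (Fin n ↪ F) := Function.Embedding.nonempty_of_card_le (by
    rw [Fintype.card_fin, hF]
    exact (le_max_left n 2).trans hle)
  let g : (Fin k → F) → Fin n → Bool := fun c i => b (∑ l : Fin k, a i ^ (l : ℕ) * c l)
  have hC : Fintype.card (Fin k → F) = (2 * h) ^ k := by simp [hF]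
  refine ⟨fun z => (#{c | g c = z} : ℝ) / Fintype.card (Fin k → F), fun z => by positivity,
    ?_, fun x hx y => ?_, ?_⟩
  · rw [sum_card_fiber_div]
    simp only [mem_univ, filter_true, card_univ]
    exact div_self (Nat.cast_ne_zero.2 Fintype.card_ne_zero)
  · have hcount := card_filter_vandermonde_mulVec hb (a.injective.comp hx) y
    have hg : #{c | g c ∈ ({z | ∀ j, z (x j) = y j} : Finset (Fin n → Bool))} =
        #{c | ∀ j, b ((Matrix.vandermonde (a ∘ x)).mulVec c j) = y j} := by
      congr 1
      ext c
      simp only [mem_filter, mem_univ, true_and]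
      rfl
    rw [sum_card_fiber_div, hg, hcount, hC]
    have hpos : (0 : ℝ) < h := by
      have := Fintype.card_pos (α := F)
      exact_mod_cast (by omega : 0 < h)
    push_cast
    rw [mul_pow, div_eq_div_iff (by positivity) (by positivity)]
    ring
  · calc _ ≤ #(univ.image g) := card_le_card fun z hz => by
          obtain ⟨c, hc⟩ := card_ne_zero.1
            (Nat.cast_ne_zero.1 (div_ne_zero_iff.1 (mem_filter.1 hz).2).1)
          exact mem_image.2 ⟨c, mem_univ c, (mem_filter.1 hc).2⟩
      _ ≤ (2 * h) ^ k := by simpa only [← hC, ← card_univ] using card_image_le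
      _ ≤ (2 * max n 2) ^ k := by gcongr
end

section
/- Let m, n, t be positive integers and let X_1, …, X_t ∈ H_m^{⊗n} be Hermitian operators with ∑_{i=1}^t X_i = I. Then there exists a POVM (P_1, …, P_t) on (ℂ^m)^{⊗n}, i.e. operators P_i ⪰ 0 with ∑_{i=1}^t P_i = I, such that ∑_{i=1}^t ⦀X_i − P_i⦀₂² ≤ (3(t+1)/m^n) · ∑_{i=1}^t Tr ζ(X_i) + 6 · ((t/m^n) · ∑_{i=1}^t Tr ζ(X_i))^{1/2}. -/
open Finset Matrix ComplexOrder

noncomputable section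

/-- Normalized squared 2-norm `⦀M⦀₂² = (1/dim)·Tr(M†M)`. -/
def nnormSq {ι : Type} [Fintype ι] (M : Matrix ι ι ℂ) : ℝ :=
  ((Mᴴ * M).trace).re / Fintype.card ι

/-- The function `ζ(x) = x²` for `x ≤ 0` and `ζ(x) = 0` for `x > 0`. -/
def zeta (x : ℝ) : ℝ := if x ≤ 0 then x ^ 2 else 0

/-- `Tr ξ(M) = ∑_i ξ(λ_i(M))` for Hermitian `M` (junk value `0` otherwise). -/
def trSpec {ι : Type} [Fintype ι] [DecidableEq ι] (ξ : ℝ → ℝ) (M : Matrix ι ι ℂ) : ℝ :=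
  if hM : M.IsHermitian then ∑ i, ξ (hM.eigenvalues i) else 0

/-- The matrix `ξ(M)` obtained by applying `ξ` to the eigenvalues of a Hermitian matrix. -/
def specMap {ι : Type} [Fintype ι] [DecidableEq ι] {M : Matrix ι ι ℂ} (hM : M.IsHermitian)
    (ξ : ℝ → ℝ) : Matrix ι ι ℂ :=
  (hM.eigenvectorUnitary : Matrix ι ι ℂ) * diagonal (fun i => (ξ (hM.eigenvalues i) : ℂ)) *
    (hM.eigenvectorUnitary : Matrix ι ι ℂ)ᴴ

section SpecMap

variable {ι : Type} [Fintype ι] [DecidableEq ι] {M : Matrix ι ι ℂ} (hM : M.IsHermitian)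

theorem conjTranspose_eigenvectorUnitary_mul_self :
    (hM.eigenvectorUnitary : Matrix ι ι ℂ)ᴴ * (hM.eigenvectorUnitary : Matrix ι ι ℂ) = 1 :=
  Unitary.coe_star_mul_self hM.eigenvectorUnitary

theorem eigenvectorUnitary_mul_conjTranspose_self :
    (hM.eigenvectorUnitary : Matrix ι ι ℂ) * (hM.eigenvectorUnitary : Matrix ι ι ℂ)ᴴ = 1 :=
  Unitary.coe_mul_star_self hM.eigenvectorUnitary

theorem specMap_id : specMap hM (fun x => x) = M := by
  conv_rhs => rw [hM.spectral_theorem]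
  rfl

theorem specMap_one : specMap hM (fun _ => 1) = 1 := by
  simp [specMap, eigenvectorUnitary_mul_conjTranspose_self]

theorem specMap_sub (ξ η : ℝ → ℝ) :
    specMap hM ξ - specMap hM η = specMap hM (fun x => ξ x - η x) := by
  simp only [specMap, ← sub_mul, ← mul_sub, diagonal_sub, Complex.ofReal_sub]

theorem specMap_mul (ξ η : ℝ → ℝ) :
    specMap hM ξ * specMap hM η = specMap hM (fun x => ξ x * η x) := by
  have h := conjTranspose_eigenvectorUnitary_mul_self hM
  simp only [specMap, Complex.ofReal_mul, ← diagonal_mul_diagonal, Matrix.mul_assoc]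
  rw [← Matrix.mul_assoc _ᴴ, h, Matrix.one_mul]

theorem specMap_congr_eigenvalues {ξ η : ℝ → ℝ}
    (h : ∀ i, ξ (hM.eigenvalues i) = η (hM.eigenvalues i)) : specMap hM ξ = specMap hM η := by
  simp only [specMap, h]

theorem trace_specMap (ξ : ℝ → ℝ) :
    (specMap hM ξ).trace.re = ∑ i, ξ (hM.eigenvalues i) := by
  rw [specMap, trace_mul_comm, ← Matrix.mul_assoc, conjTranspose_eigenvectorUnitary_mul_self,
    Matrix.one_mul, trace_diagonal]
  simp

theorem posSemidef_specMap {ξ : ℝ → ℝ} (h : ∀ i, 0 ≤ ξ (hM.eigenvalues i)) :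
    (specMap hM ξ).PosSemidef := by
  refine PosSemidef.mul_mul_conjTranspose_same (PosSemidef.diagonal fun i => ?_) _
  simpa using h i

theorem isHermitian_specMap (ξ : ℝ → ℝ) : (specMap hM ξ).IsHermitian := by
  refine isHermitian_mul_mul_conjTranspose _ ?_
  rw [IsHermitian, diagonal_conjTranspose]
  congr 1
  ext i
  simp

end SpecMap

section Trace

variable {ι : Type} [Fintype ι]

/-- The trace of a product of positive semidefinite matrices is nonnegative. -/
theorem trace_mul_re_nonneg {A B : Matrix ι ι ℂ} (hA : A.PosSemidef) (hB : B.PosSemidef) :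
    0 ≤ (A * B).trace.re := by
  classical
  have hsq : specMap hA.1 Real.sqrt * specMap hA.1 Real.sqrt = A := by
    rw [specMap_mul, specMap_congr_eigenvalues hA.1 (η := fun x => x), specMap_id]
    exact fun i => Real.mul_self_sqrt (hA.eigenvalues_nonneg i)
  have h := hB.mul_mul_conjTranspose_same (specMap hA.1 Real.sqrt)
  rw [(isHermitian_specMap _ _).eq] at h
  rw [← hsq, Matrix.mul_assoc, trace_mul_comm]
  exact (Complex.le_def.mp h.trace_nonneg).1

theorem trace_mul_re_le_of_posSemidef_sub {A A' B : Matrix ι ι ℂ} (hA : (A' - A).PosSemidef)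
    (hB : B.PosSemidef) : (A * B).trace.re ≤ (A' * B).trace.re := by
  have h := trace_mul_re_nonneg hA hB
  rw [Matrix.sub_mul, trace_sub, Complex.sub_re] at h
  linarith

theorem trace_conjTranspose_mul_self_re (M : Matrix ι ι ℂ) :
    (Mᴴ * M).trace.re = ∑ i, ∑ j, ‖M j i‖ ^ 2 := by
  simp only [trace, Matrix.diag, mul_apply, conjTranspose_apply, Complex.re_sum]
  refine sum_congr rfl fun i _ => sum_congr rfl fun j _ => ?_
  rw [← Complex.normSq_eq_norm_sq, Complex.star_def, ← Complex.normSq_eq_conj_mul_self,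
    Complex.ofReal_re]

theorem trace_conjTranspose_mul_self_sum_le {κ : Type} [Fintype κ] (M : κ → Matrix ι ι ℂ) :
    ((∑ k, M k)ᴴ * ∑ k, M k).trace.re ≤
      Fintype.card κ * ∑ k, ((M k)ᴴ * M k).trace.re := by
  simp only [trace_conjTranspose_mul_self_re, Matrix.sum_apply]
  calc ∑ i, ∑ j, ‖∑ k, M k j i‖ ^ 2
      ≤ ∑ i, ∑ j, (Fintype.card κ : ℝ) * ∑ k, ‖M k j i‖ ^ 2 := by
        refine sum_le_sum fun i _ => sum_le_sum fun j _ => ?_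
        exact (pow_le_pow_left₀ (norm_nonneg _) (norm_sum_le _ _) 2).trans
          sq_sum_le_card_mul_sum_sq
    _ = Fintype.card κ * ∑ k, ∑ i, ∑ j, ‖M k j i‖ ^ 2 := by
        simp only [← mul_sum]
        rw [sum_comm (s := univ (α := κ))]
        exact congrArg _ (sum_congr rfl fun i _ => sum_comm)

theorem trace_conjTranspose_mul_self_add_sub_le (A B C : Matrix ι ι ℂ) :
    ((A + B - C)ᴴ * (A + B - C)).trace.re ≤
      3 * ((Aᴴ * A).trace.re + (Bᴴ * B).trace.re + (Cᴴ * C).trace.re) := by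
  have h := trace_conjTranspose_mul_self_sum_le ![A, B, -C]
  simpa [Fin.sum_univ_three, sub_eq_add_neg] using h

/-- Cauchy–Schwarz for the trace of a Hermitian matrix. -/
theorem trace_re_le_sqrt [DecidableEq ι] {M : Matrix ι ι ℂ} (hM : M.IsHermitian) :
    M.trace.re ≤ Real.sqrt (Fintype.card ι * (M * M).trace.re) := by
  apply Real.le_sqrt_of_sq_le
  have h1 := trace_specMap hM (fun x => x)
  have h2 := trace_specMap hM (fun x => x * x)
  rw [← specMap_mul, specMap_id] at h2
  rw [specMap_id] at h1
  rw [h1, h2]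
  simpa [sq] using sq_sum_le_card_mul_sum_sq (s := univ) (f := hM.eigenvalues)

end Trace

section Rounding

variable {ι : Type} [Fintype ι] [DecidableEq ι]

theorem exists_psd_decomposition {X : Matrix ι ι ℂ} (hX : X.IsHermitian) :
    ∃ A B : Matrix ι ι ℂ, A.PosSemidef ∧ B.PosSemidef ∧ X = A - B ∧
      (Bᴴ * B).trace.re = trSpec zeta X := by
  refine ⟨specMap hX (fun x => max x 0), specMap hX (fun x => max (-x) 0),
    posSemidef_specMap hX fun _ => le_max_right _ _,
    posSemidef_specMap hX fun _ => le_max_right _ _, ?_, ?_⟩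
  · rw [specMap_sub]
    conv_lhs => rw [← specMap_id hX]
    congr 1
    ext x
    rcases le_total x 0 with h | h <;> simp [h]
  · rw [(isHermitian_specMap hX _).eq, specMap_mul, trace_specMap, trSpec, dif_pos hX]
    refine sum_congr rfl fun i _ => ?_
    rw [zeta]
    split_ifs with h
    · rw [max_eq_left (by linarith)]; ring
    · rw [max_eq_right (by linarith)]; ring

/-- The square root `Q` of `1 + B`, its inverse `R`, and the bound `(Q - 1)² ≤ B`. -/
theorem exists_sqrt_one_add {B : Matrix ι ι ℂ} (hB : B.PosSemidef) :
    ∃ Q R : Matrix ι ι ℂ, Q.IsHermitian ∧ R.IsHermitian ∧ Q * R = 1 ∧ R * Q = 1 ∧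
      Q * Q = 1 + B ∧ (B - (Q - 1) * (Q - 1)).PosSemidef := by
  have h0 := hB.eigenvalues_nonneg
  have hsq : ∀ i, √(1 + hB.1.eigenvalues i) * √(1 + hB.1.eigenvalues i)
      = 1 + hB.1.eigenvalues i := fun i => Real.mul_self_sqrt (by linarith [h0 i])
  have hge : ∀ i, 1 ≤ √(1 + hB.1.eigenvalues i) := fun i =>
    Real.one_le_sqrt.mpr (by linarith [h0 i])
  have hQQ : specMap hB.1 (fun x => √(1 + x)) * specMap hB.1 (fun x => √(1 + x)) = 1 + B := by
    rw [specMap_mul, ← sub_eq_iff_eq_add']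
    conv_lhs => rw [← specMap_one hB.1]
    conv_rhs => rw [← specMap_id hB.1]
    rw [specMap_sub]
    exact specMap_congr_eigenvalues _ fun i => by rw [hsq]; ring
  have hQR : specMap hB.1 (fun x => √(1 + x)) * specMap hB.1 (fun x => (√(1 + x))⁻¹) = 1 := by
    conv_rhs => rw [← specMap_one hB.1]
    rw [specMap_mul]
    exact specMap_congr_eigenvalues _ fun i =>
      mul_inv_cancel₀ (by linarith [hge i])
  refine ⟨_, _, isHermitian_specMap hB.1 _, isHermitian_specMap hB.1 _, hQR,
    mul_eq_one_comm.mp hQR, hQQ, ?_⟩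
  have h : B - (specMap hB.1 (fun x => √(1 + x)) - 1) * (specMap hB.1 (fun x => √(1 + x)) - 1)
      = specMap hB.1 (fun x => x - (√(1 + x) - 1) * (√(1 + x) - 1)) := by
    rw [← specMap_sub, ← specMap_mul, ← specMap_sub, specMap_one, specMap_id]
  rw [h]
  refine posSemidef_specMap _ fun i => ?_
  nlinarith [hsq i, hge i]

/-- An effect `P` satisfies `P² ≤ P`. -/
theorem posSemidef_sub_mul_self {P : Matrix ι ι ℂ} (hP : P.PosSemidef)
    (hP1 : (1 - P).PosSemidef) : (P - P * P).PosSemidef := by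
  have h1 := hP1.mul_mul_conjTranspose_same P
  have h2 := hP.mul_mul_conjTranspose_same (1 - P)
  rw [hP.1.eq] at h1
  rw [hP1.1.eq] at h2
  convert h1.add h2 using 1
  noncomm_ring

/-- The cost of replacing `Q P Q` by the effect `P`, where `Q² = 1 + B`. -/
theorem trace_rounding_error_le {B Q P C : Matrix ι ι ℂ} (hB : B.PosSemidef)
    (hQ : Q.IsHermitian) (hQQ : Q * Q = 1 + B) (hQB : (B - (Q - 1) * (Q - 1)).PosSemidef)
    (hP : P.PosSemidef) (hP1 : (1 - P).PosSemidef) :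
    ((Q * P * Q - C - P)ᴴ * (Q * P * Q - C - P)).trace.re ≤
      3 * (2 * (P * B).trace.re + (P * (B * B)).trace.re + (Cᴴ * C).trace.re) := by
  set E := Q - 1 with hE
  have hEh : E.IsHermitian := hQ.sub isHermitian_one
  have hEE : (E * E).PosSemidef := by
    simpa [hEh.eq] using posSemidef_conjTranspose_mul_self E
  have hsplit : Q * P * Q - C - P = E * P * Q + P * E - C := by
    rw [hE]; noncomm_ring
  have hPE : ((P * E)ᴴ * (P * E)).trace.re ≤ (P * B).trace.re := by
    rw [conjTranspose_mul, hEh.eq, hP.1.eq]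
    have h : (E * P * (P * E)).trace = (P * P * (E * E)).trace := by
      rw [Matrix.mul_assoc, trace_mul_comm]; simp only [Matrix.mul_assoc]
    rw [h]
    refine (trace_mul_re_le_of_posSemidef_sub (posSemidef_sub_mul_self hP hP1) hEE).trans ?_
    rw [trace_mul_comm P, trace_mul_comm P]
    exact trace_mul_re_le_of_posSemidef_sub hQB hP
  have hPBP : (P * B * P).PosSemidef := by
    simpa [hP.1.eq] using hB.mul_mul_conjTranspose_same P
  have hBPB : (B * P * B).PosSemidef := by
    simpa [hB.1.eq] using hP.mul_mul_conjTranspose_same B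
  have hcross : (E * E * (P * B * P)).trace.re ≤ (P * (B * B)).trace.re := by
    refine (trace_mul_re_le_of_posSemidef_sub hQB hPBP).trans ?_
    have h := trace_mul_re_le_of_posSemidef_sub hP1 hBPB
    have hl : (P * (B * P * B)).trace = (B * (P * B * P)).trace := by
      rw [trace_mul_comm B]
      simp only [Matrix.mul_assoc]
    have hr : (1 * (B * P * B)).trace = (P * (B * B)).trace := by
      rw [Matrix.one_mul, Matrix.mul_assoc, trace_mul_comm, Matrix.mul_assoc]
    rwa [hl, hr] at h
  have hEPQ : ((E * P * Q)ᴴ * (E * P * Q)).trace.re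
      ≤ (P * B).trace.re + (P * (B * B)).trace.re := by
    have h : ((E * P * Q)ᴴ * (E * P * Q)).trace
        = ((P * E)ᴴ * (P * E)).trace + (E * E * (P * B * P)).trace := by
      simp only [conjTranspose_mul, hEh.eq, hP.1.eq, hQ.eq]
      calc (Q * (P * E) * (E * P * Q)).trace = (E * E * (P * (Q * Q) * P)).trace := by
            rw [trace_mul_comm, trace_mul_comm (E * E)]
            have h : E * P * Q * (Q * (P * E)) = E * (P * Q * Q * P * E) := by
              simp only [Matrix.mul_assoc]
            rw [h, trace_mul_comm]
            simp only [Matrix.mul_assoc]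
        _ = (E * E * (P * P)).trace + (E * E * (P * B * P)).trace := by
            rw [hQQ, ← trace_add]
            congr 1
            noncomm_ring
        _ = _ := by
            rw [Matrix.mul_assoc, trace_mul_comm E (E * _)]
            simp only [Matrix.mul_assoc]
    rw [h, Complex.add_re]
    exact add_le_add hPE hcross
  rw [hsplit]
  refine (trace_conjTranspose_mul_self_add_sub_le _ _ _).trans ?_
  linarith

end Rounding

/-- rounding to a POVM: Hermitian operators summing to the identity
can be rounded to a POVM at cost controlled by their distances `Tr ζ(X_i)` to the PSD
cone. -/
theorem stmt12 (m n t : ℕ) (hm : 0 < m) (hn : 0 < n) (ht : 0 < t)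
    (X : Fin t → Matrix (Fin n → Fin m) (Fin n → Fin m) ℂ)
    (hherm : ∀ i, (X i).IsHermitian)
    (hsum : ∑ i, X i = 1) :
    ∃ P : Fin t → Matrix (Fin n → Fin m) (Fin n → Fin m) ℂ,
      (∀ i, (P i).PosSemidef) ∧ (∑ i, P i = 1) ∧
      ∑ i, nnormSq (X i - P i)
        ≤ (3 * (t + 1) / (m : ℝ) ^ n) * ∑ i, trSpec zeta (X i) +
          6 * Real.sqrt (((t : ℝ) / (m : ℝ) ^ n) * ∑ i, trSpec zeta (X i)) := by
  choose A C hA hC hX hCz using fun i => exists_psd_decomposition (hherm i)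
  set B := ∑ i, C i with hBdef
  have hB : B.PosSemidef := posSemidef_sum _ fun i _ => hC i
  have hAsum : ∑ i, A i = 1 + B := by
    rw [hBdef, ← hsum, ← sum_add_distrib]
    exact sum_congr rfl fun i _ => by rw [hX i]; abel
  obtain ⟨Q, R, hQ, hR, hQR, hRQ, hQQ, hQB⟩ := exists_sqrt_one_add hB
  have hP : ∀ i, (R * A i * R).PosSemidef := fun i => by
    simpa [hR.eq] using (hA i).mul_mul_conjTranspose_same R
  have hPsum : ∑ i, R * A i * R = 1 := by
    rw [← sum_mul, ← mul_sum, hAsum, ← hQQ, ← Matrix.mul_assoc, hRQ, Matrix.one_mul, hQR]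
  have hP1 : ∀ i, (1 - R * A i * R).PosSemidef := fun i => by
    rw [← hPsum, ← sum_erase_add _ _ (mem_univ i), add_sub_cancel_right]
    exact posSemidef_sum _ fun j _ => hP j
  have hQPQ : ∀ i, Q * (R * A i * R) * Q = A i := fun i => by
    have h : Q * (R * A i * R) * Q = (Q * R) * A i * (R * Q) := by
      simp only [Matrix.mul_assoc]
    rw [h, hQR, hRQ, Matrix.one_mul, Matrix.mul_one]
  have hbound : ∑ i, ((X i - R * A i * R)ᴴ * (X i - R * A i * R)).trace.re ≤
      3 * (2 * B.trace.re + (B * B).trace.re + ∑ i, trSpec zeta (X i)) := by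
    have hlin : ∀ M : Matrix (Fin n → Fin m) (Fin n → Fin m) ℂ,
        ∑ i, (R * A i * R * M).trace.re = M.trace.re := fun M => by
      rw [← Complex.re_sum, ← trace_sum, ← sum_mul, hPsum, Matrix.one_mul]
    calc _ ≤ ∑ i, 3 * (2 * (R * A i * R * B).trace.re + (R * A i * R * (B * B)).trace.re
          + trSpec zeta (X i)) := by
          refine sum_le_sum fun i _ => ?_
          have h := trace_rounding_error_le (C := C i) hB hQ hQQ hQB (hP i) (hP1 i)
          rwa [hQPQ, ← hX, hCz] at h
      _ = _ := by
          rw [← mul_sum, sum_add_distrib, sum_add_distrib, ← mul_sum, hlin, hlin]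
  have hBB : (B * B).trace.re ≤ t * ∑ i, trSpec zeta (X i) := by
    have h := trace_conjTranspose_mul_self_sum_le C
    rw [← hBdef, hB.1.eq, Fintype.card_fin] at h
    simpa only [hCz] using h
  have hcard : (Fintype.card (Fin n → Fin m) : ℝ) = (m : ℝ) ^ n := by simp
  have hD : (0 : ℝ) < (m : ℝ) ^ n := by positivity
  have htr : B.trace.re / (m : ℝ) ^ n ≤ √((t : ℝ) / (m : ℝ) ^ n * ∑ i, trSpec zeta (X i)) := by
    have h := trace_re_le_sqrt hB.1
    rw [hcard] at h
    rw [div_le_iff₀ hD]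
    refine h.trans (Real.sqrt_le_iff.mpr ⟨by positivity, ?_⟩)
    have hS : 0 ≤ ∑ i, trSpec zeta (X i) := sum_nonneg fun i _ => by
      rw [← hCz, trace_conjTranspose_mul_self_re]
      positivity
    rw [mul_pow, Real.sq_sqrt (by positivity)]
    calc _ ≤ (m : ℝ) ^ n * (t * ∑ i, trSpec zeta (X i)) := by gcongr
      _ = _ := by field_simp
  refine ⟨fun i => R * A i * R, hP, hPsum, ?_⟩
  simp only [nnormSq, hcard]
  rw [← sum_div]
  calc _ ≤ (3 * (2 * B.trace.re + t * ∑ i, trSpec zeta (X i) + ∑ i, trSpec zeta (X i)))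
        / (m : ℝ) ^ n := by
        gcongr
        linarith
    _ = 3 * (t + 1) / (m : ℝ) ^ n * ∑ i, trSpec zeta (X i) + 6 * (B.trace.re / (m : ℝ) ^ n) := by
        ring
    _ ≤ _ := by gcongr

end
end

section
/- Let m ≥ 2 and D ≥ 1 be integers, let 0 < δ < 1, and let {P^x_a}_{x∈X, a∈A} and {Q^y_b}_{y∈Y, b∈B} be families in H_m^{⊗D} such that ∑_{a∈A} P^x_a = I and ∑_{b∈B} Q^y_b = I for all x, y, and such that every Fourier coefficient satisfies |P̂^x_a(σ)| ≤ 1 and |Q̂^y_b(σ)| ≤ 1. Let w = ⌈D·log₂ m + log₂(2/δ)⌉. Then there exist families {P'^x_a} and {Q'^y_b} in H_m^{⊗D} such that: (1) every Fourier coefficient of every P'^x_a and Q'^y_b is an integer multiple of 2^{−w} with absolute value at most 1; (2) ∑_{a∈A} P'^x_a = I and ∑_{b∈B} Q'^y_b = I for all x, y; and (3) ⦀P'^x_a − P^x_a⦀₂ ≤ δ/2 and ⦀Q'^y_b − Q^y_b⦀₂ ≤ δ/2 for all x, a, y, b. -/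
open Finset Matrix

noncomputable section

/-- `B` is a standard orthonormal basis of the space of `m × m` Hermitian matrices. -/
def IsStdONB (m : ℕ) [NeZero m] (B : Fin (m ^ 2) → Matrix (Fin m) (Fin m) ℂ) : Prop :=
  (∀ i, (B i).IsHermitian) ∧ B 0 = 1 ∧
  (∀ i j, ((B i)ᴴ * B j).trace = if i = j then (m : ℂ) else 0)

/-- Tensor product `B_σ = B_{σ_1} ⊗ … ⊗ B_{σ_D}`. -/
def tensorB {m D : ℕ} (B : Fin (m ^ 2) → Matrix (Fin m) (Fin m) ℂ)
    (σ : Fin D → Fin (m ^ 2)) : Matrix (Fin D → Fin m) (Fin D → Fin m) ℂ :=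
  fun a b => ∏ t, B (σ t) (a t) (b t)

/-- Normalized 2-norm `⦀M⦀₂`. -/
def nnorm2 {ι : Type} [Fintype ι] (M : Matrix ι ι ℂ) : ℝ := Real.sqrt (nnormSq M)

/-- The Fourier coefficient `P̂(σ) = ⟨B_σ, P⟩ = (1/m^D)·Tr(B_σ† P)` of `P ∈ H_m^{⊗D}`
with respect to the standard orthonormal basis `B`. -/
def fCoeff {m D : ℕ} (B : Fin (m ^ 2) → Matrix (Fin m) (Fin m) ℂ)
    (P : Matrix (Fin D → Fin m) (Fin D → Fin m) ℂ) (σ : Fin D → Fin (m ^ 2)) : ℝ :=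
  ((((tensorB B σ)ᴴ * P).trace) / (m ^ D : ℂ)).re

/-- Reals with an integer sum can be rounded to integers, each moving by less than one, so that
the sum is preserved. -/
lemma exists_int_rounding {ι : Type} [Fintype ι] (c : ι → ℝ) (s : ℤ) (hs : ∑ a, c a = s) :
    ∃ z : ι → ℤ, ∑ a, z a = s ∧ ∀ a, |(z a : ℝ) - c a| < 1 := by
  classical
  have hfr : ((s - ∑ a, ⌊c a⌋ : ℤ) : ℝ) = ∑ a, Int.fract (c a) := by
    push_cast
    rw [← hs, ← Finset.sum_sub_distrib]
    rfl
  have hnonneg : 0 ≤ s - ∑ a, ⌊c a⌋ := by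
    have : (0 : ℝ) ≤ ((s - ∑ a, ⌊c a⌋ : ℤ) : ℝ) := by
      rw [hfr]
      exact Finset.sum_nonneg fun a _ => Int.fract_nonneg _
    exact_mod_cast this
  obtain ⟨k, hk⟩ := Int.eq_ofNat_of_zero_le hnonneg
  have hcard : k ≤ (Finset.univ.filter fun a => Int.fract (c a) ≠ 0).card := by
    have : (k : ℝ) ≤ ((Finset.univ.filter fun a => Int.fract (c a) ≠ 0).card : ℝ) := by
      calc (k : ℝ) = ∑ a, Int.fract (c a) := by rw [← hfr, hk]; simp
        _ = ∑ a ∈ Finset.univ.filter fun a => Int.fract (c a) ≠ 0, Int.fract (c a) :=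
            (Finset.sum_filter_ne_zero _).symm
        _ ≤ ∑ a ∈ Finset.univ.filter fun a => Int.fract (c a) ≠ 0, (1 : ℝ) :=
            Finset.sum_le_sum fun a _ => (Int.fract_lt_one _).le
        _ = _ := by simp
    exact_mod_cast this
  obtain ⟨T, hT, hTk⟩ := Finset.exists_subset_card_eq hcard
  refine ⟨fun a => ⌊c a⌋ + if a ∈ T then 1 else 0, ?_, fun a => ?_⟩
  · rw [Finset.sum_add_distrib]
    simp only [Finset.sum_ite_mem, Finset.univ_inter, Finset.sum_const, hTk]
    simp only [nsmul_eq_mul, mul_one]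
    have : s - ∑ a, ⌊c a⌋ = (k : ℤ) := hk
    push_cast
    linarith
  · have h0 := Int.fract_nonneg (c a)
    have h1 := Int.fract_lt_one (c a)
    have hf : (⌊c a⌋ : ℝ) = c a - Int.fract (c a) := (Int.self_sub_fract _).symm
    beta_reduce
    rw [abs_lt]
    split_ifs with ha
    · have hpos : 0 < Int.fract (c a) :=
        lt_of_le_of_ne h0 (Ne.symm (Finset.mem_filter.1 (hT ha)).2)
      push_cast
      constructor <;> linarith
    · push_cast
      constructor <;> linarith

/-- Orthogonality of the tensor basis. -/
lemma trace_conjTranspose_tensorB_mul {m D : ℕ} [NeZero m]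
    {B : Fin (m ^ 2) → Matrix (Fin m) (Fin m) ℂ} (hB : IsStdONB m B)
    (σ τ : Fin D → Fin (m ^ 2)) :
    ((tensorB B σ)ᴴ * tensorB B τ).trace = if σ = τ then (m : ℂ) ^ D else 0 := by
  have hprod : ((tensorB B σ)ᴴ * tensorB B τ).trace
      = ∏ t, ((B (σ t))ᴴ * B (τ t)).trace := by
    simp only [Matrix.trace, Matrix.diag, Matrix.mul_apply, Matrix.conjTranspose_apply, tensorB,
      star_prod, ← Finset.prod_mul_distrib]
    simp only [Fintype.prod_sum]
  rw [hprod]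
  simp only [hB.2.2]
  split_ifs with h
  · simp [h]
  · obtain ⟨t, ht⟩ := Function.ne_iff.1 h
    exact Finset.prod_eq_zero (Finset.mem_univ t) (if_neg ht)

lemma tensorB_isHermitian {m D : ℕ} [NeZero m]
    {B : Fin (m ^ 2) → Matrix (Fin m) (Fin m) ℂ} (hB : IsStdONB m B)
    (σ : Fin D → Fin (m ^ 2)) : (tensorB B σ).IsHermitian := by
  ext a b
  simp only [Matrix.conjTranspose_apply, tensorB, star_prod]
  exact Finset.prod_congr rfl fun t _ => (hB.1 (σ t)).apply _ _

lemma tensorB_zero {m D : ℕ} [NeZero m]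
    {B : Fin (m ^ 2) → Matrix (Fin m) (Fin m) ℂ} (hB : IsStdONB m B) :
    tensorB B (0 : Fin D → Fin (m ^ 2)) = 1 := by
  ext a b
  simp only [tensorB, Pi.zero_apply, hB.2.1, Matrix.one_apply, Finset.prod_ite_zero, funext_iff]
  simp

lemma fCoeff_add {m D : ℕ} (B : Fin (m ^ 2) → Matrix (Fin m) (Fin m) ℂ)
    (P Q : Matrix (Fin D → Fin m) (Fin D → Fin m) ℂ) (σ : Fin D → Fin (m ^ 2)) :
    fCoeff B (P + Q) σ = fCoeff B P σ + fCoeff B Q σ := by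
  simp [fCoeff, mul_add, add_div]

lemma fCoeff_sum {m D : ℕ} (B : Fin (m ^ 2) → Matrix (Fin m) (Fin m) ℂ) {ι : Type} [Fintype ι]
    (P : ι → Matrix (Fin D → Fin m) (Fin D → Fin m) ℂ) (σ : Fin D → Fin (m ^ 2)) :
    fCoeff B (∑ a, P a) σ = ∑ a, fCoeff B (P a) σ := by
  simp [fCoeff, Finset.mul_sum, Matrix.trace_sum, Finset.sum_div]

/-- The matrix with prescribed real Fourier coefficients. -/
def ofCoeff {m D : ℕ} (B : Fin (m ^ 2) → Matrix (Fin m) (Fin m) ℂ)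
    (d : (Fin D → Fin (m ^ 2)) → ℝ) : Matrix (Fin D → Fin m) (Fin D → Fin m) ℂ :=
  ∑ σ, (d σ : ℂ) • tensorB B σ

lemma trace_conjTranspose_tensorB_mul_ofCoeff {m D : ℕ} [NeZero m]
    {B : Fin (m ^ 2) → Matrix (Fin m) (Fin m) ℂ} (hB : IsStdONB m B)
    (d : (Fin D → Fin (m ^ 2)) → ℝ) (σ : Fin D → Fin (m ^ 2)) :
    ((tensorB B σ)ᴴ * ofCoeff B d).trace = d σ * (m : ℂ) ^ D := by
  simp [ofCoeff, Finset.mul_sum, Matrix.trace_sum, trace_conjTranspose_tensorB_mul hB]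

lemma ofCoeff_isHermitian {m D : ℕ} [NeZero m]
    {B : Fin (m ^ 2) → Matrix (Fin m) (Fin m) ℂ} (hB : IsStdONB m B)
    (d : (Fin D → Fin (m ^ 2)) → ℝ) : (ofCoeff B d).IsHermitian := by
  simp only [Matrix.IsHermitian, ofCoeff, Matrix.conjTranspose_sum, Matrix.conjTranspose_smul,
    (tensorB_isHermitian hB _).eq]
  simp

lemma fCoeff_ofCoeff {m D : ℕ} [NeZero m]
    {B : Fin (m ^ 2) → Matrix (Fin m) (Fin m) ℂ} (hB : IsStdONB m B)
    (d : (Fin D → Fin (m ^ 2)) → ℝ) (σ : Fin D → Fin (m ^ 2)) :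
    fCoeff B (ofCoeff B d) σ = d σ := by
  have hm : (m : ℂ) ^ D ≠ 0 := pow_ne_zero _ (Nat.cast_ne_zero.2 (NeZero.ne m))
  rw [fCoeff, trace_conjTranspose_tensorB_mul_ofCoeff hB, mul_div_cancel_right₀ _ hm,
    Complex.ofReal_re]

lemma fCoeff_one {m D : ℕ} [NeZero m]
    {B : Fin (m ^ 2) → Matrix (Fin m) (Fin m) ℂ} (hB : IsStdONB m B)
    (σ : Fin D → Fin (m ^ 2)) :
    fCoeff B 1 σ = if σ = 0 then 1 else 0 := by
  have hm : (m : ℂ) ^ D ≠ 0 := pow_ne_zero _ (Nat.cast_ne_zero.2 (NeZero.ne m))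
  rw [fCoeff, ← tensorB_zero hB, trace_conjTranspose_tensorB_mul hB]
  split_ifs <;> simp [hm]

/-- Parseval's identity. -/
lemma nnormSq_ofCoeff {m D : ℕ} [NeZero m]
    {B : Fin (m ^ 2) → Matrix (Fin m) (Fin m) ℂ} (hB : IsStdONB m B)
    (d : (Fin D → Fin (m ^ 2)) → ℝ) : nnormSq (ofCoeff B d) = ∑ σ, d σ ^ 2 := by
  have hm : (m : ℝ) ^ D ≠ 0 := pow_ne_zero _ (Nat.cast_ne_zero.2 (NeZero.ne m))
  have htr : ((ofCoeff B d)ᴴ * ofCoeff B d).trace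
      = (((∑ σ, d σ ^ 2) * (m : ℝ) ^ D : ℝ) : ℂ) := by
    have hexp : (ofCoeff B d)ᴴ = ∑ σ, (d σ : ℂ) • (tensorB B σ)ᴴ := by
      simp [ofCoeff, Matrix.conjTranspose_sum, Matrix.conjTranspose_smul]
    rw [hexp, Finset.sum_mul, Matrix.trace_sum]
    simp only [Matrix.smul_mul, Matrix.trace_smul, smul_eq_mul,
      trace_conjTranspose_tensorB_mul_ofCoeff hB]
    push_cast
    rw [Finset.sum_mul]
    exact Finset.sum_congr rfl fun σ _ => by ring
  rw [nnormSq, htr, Complex.ofReal_re]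
  simp [hm]

/-- A family summing to the identity can have its Fourier coefficients rounded to multiples of
`1 / N`, keeping the sum, with error at most `m ^ D / N` in the normalized 2-norm. -/
lemma exists_rounded_family {m D : ℕ} [NeZero m]
    {B : Fin (m ^ 2) → Matrix (Fin m) (Fin m) ℂ} (hB : IsStdONB m B) {N : ℕ} (hN : 0 < N)
    {ι : Type} [Fintype ι] (P : ι → Matrix (Fin D → Fin m) (Fin D → Fin m) ℂ)
    (hPh : ∀ a, (P a).IsHermitian) (hPsum : ∑ a, P a = 1)
    (hPc : ∀ a σ, |fCoeff B (P a) σ| ≤ 1) :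
    ∃ P' : ι → Matrix (Fin D → Fin m) (Fin D → Fin m) ℂ,
      (∀ a, (P' a).IsHermitian) ∧
      (∀ a σ, ∃ z : ℤ, fCoeff B (P' a) σ = z / N ∧ |fCoeff B (P' a) σ| ≤ 1) ∧
      ∑ a, P' a = 1 ∧ ∀ a, nnorm2 (P' a - P a) ≤ (m : ℝ) ^ D / N := by
  have hN' : (0 : ℝ) < N := Nat.cast_pos.2 hN
  have hround : ∀ σ : Fin D → Fin (m ^ 2), ∃ z : ι → ℤ,
      ∑ a, z a = (N : ℤ) * (if σ = 0 then 1 else 0) ∧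
      ∀ a, |(z a : ℝ) - N * fCoeff B (P a) σ| < 1 := fun σ => by
    refine exists_int_rounding _ _ ?_
    rw [← Finset.mul_sum, ← fCoeff_sum, hPsum, fCoeff_one hB]
    push_cast
    rfl
  choose z hzsum hz using hround
  have hcoeff : ∀ a σ, fCoeff B
      (P a + ofCoeff B fun σ => (z σ a : ℝ) / N - fCoeff B (P a) σ) σ = z σ a / N := fun a σ => by
    rw [fCoeff_add, fCoeff_ofCoeff hB]
    ring
  refine ⟨fun a => P a + ofCoeff B fun σ => (z σ a : ℝ) / N - fCoeff B (P a) σ,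
    fun a => (hPh a).add (ofCoeff_isHermitian hB _), fun a σ => ⟨z σ a, hcoeff a σ, ?_⟩, ?_,
    fun a => ?_⟩
  · rw [hcoeff, abs_div, Nat.abs_cast, div_le_one hN']
    have hlt : |(z σ a : ℝ)| < N + 1 := by
      have hc : |(N : ℝ) * fCoeff B (P a) σ| ≤ N := by
        rw [abs_mul, Nat.abs_cast]
        exact mul_le_of_le_one_right hN'.le (hPc a σ)
      have := abs_sub_abs_le_abs_sub (z σ a : ℝ) (N * fCoeff B (P a) σ)
      linarith [hz σ a]
    have hlt' : |z σ a| < N + 1 := by exact_mod_cast hlt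
    exact_mod_cast Int.lt_add_one_iff.1 hlt'
  · rw [Finset.sum_add_distrib, hPsum]
    simp only [ofCoeff]
    rw [Finset.sum_comm]
    simp only [← Finset.sum_smul, ← Complex.ofReal_sum]
    have hzero : ∀ σ, ∑ a, ((z σ a : ℝ) / N - fCoeff B (P a) σ) = 0 := fun σ => by
      rw [Finset.sum_sub_distrib, ← fCoeff_sum, hPsum, fCoeff_one hB, ← Finset.sum_div,
        ← Int.cast_sum, hzsum]
      push_cast
      rw [mul_div_cancel_left₀ _ hN'.ne', sub_self]
    simp [hzero]
  · rw [add_sub_cancel_left, nnorm2, nnormSq_ofCoeff hB]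
    refine Real.sqrt_le_iff.2 ⟨by positivity, ?_⟩
    calc ∑ σ, ((z σ a : ℝ) / N - fCoeff B (P a) σ) ^ 2
        ≤ ∑ _σ : Fin D → Fin (m ^ 2), (1 / (N : ℝ)) ^ 2 := by
          refine Finset.sum_le_sum fun σ _ => ?_
          rw [← sq_abs]
          refine pow_le_pow_left₀ (abs_nonneg _) ?_ 2
          have : (z σ a : ℝ) / N - fCoeff B (P a) σ = (z σ a - N * fCoeff B (P a) σ) / N := by
            field_simp
          rw [this, abs_div, Nat.abs_cast]
          gcongr
          exact (hz σ a).le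
      _ = ((m : ℝ) ^ D / N) ^ 2 := by
          simp
          ring

lemma pow_div_two_pow_ceil_le {m D : ℕ} [NeZero m] {δ : ℝ} (hδ : 0 < δ) :
    (m : ℝ) ^ D / (2 ^ ⌈(D : ℝ) * Real.logb 2 m + Real.logb 2 (2 / δ)⌉₊ : ℕ) ≤ δ / 2 := by
  have hm : (0 : ℝ) < m := Nat.cast_pos.2 (NeZero.pos m)
  have hle : (m : ℝ) ^ D * (2 / δ) ≤
      2 ^ ⌈(D : ℝ) * Real.logb 2 m + Real.logb 2 (2 / δ)⌉₊ := by
    rw [← Real.rpow_natCast 2, ← Real.logb_le_iff_le_rpow one_lt_two (by positivity),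
      Real.logb_mul (by positivity) (by positivity), Real.logb_pow]
    exact Nat.le_ceil _
  push_cast
  rw [div_le_iff₀ (by positivity)]
  calc (m : ℝ) ^ D = δ / 2 * ((m : ℝ) ^ D * (2 / δ)) := by field_simp
    _ ≤ _ := by gcongr

/-- truncation of Fourier coefficients. -/
theorem stmt13 (m D : ℕ) [NeZero m] (hm : 2 ≤ m) (hD : 1 ≤ D)
    (δ : ℝ) (hδ0 : 0 < δ) (hδ1 : δ < 1)
    (B : Fin (m ^ 2) → Matrix (Fin m) (Fin m) ℂ) (hB : IsStdONB m B)
    (X Y A' B' : Type) [Fintype X] [Fintype Y] [Fintype A'] [Fintype B']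
    (P : X → A' → Matrix (Fin D → Fin m) (Fin D → Fin m) ℂ)
    (Q : Y → B' → Matrix (Fin D → Fin m) (Fin D → Fin m) ℂ)
    (hPh : ∀ x a, (P x a).IsHermitian) (hQh : ∀ y b, (Q y b).IsHermitian)
    (hPsum : ∀ x, ∑ a, P x a = 1) (hQsum : ∀ y, ∑ b, Q y b = 1)
    (hPc : ∀ x a σ, |fCoeff B (P x a) σ| ≤ 1)
    (hQc : ∀ y b σ, |fCoeff B (Q y b) σ| ≤ 1) :
    ∃ (P' : X → A' → Matrix (Fin D → Fin m) (Fin D → Fin m) ℂ)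
      (Q' : Y → B' → Matrix (Fin D → Fin m) (Fin D → Fin m) ℂ),
      (∀ x a, (P' x a).IsHermitian) ∧ (∀ y b, (Q' y b).IsHermitian) ∧
      (∀ x a σ, ∃ z : ℤ,
        fCoeff B (P' x a) σ =
          z / 2 ^ (⌈(D : ℝ) * Real.logb 2 m + Real.logb 2 (2 / δ)⌉₊) ∧
        |fCoeff B (P' x a) σ| ≤ 1) ∧
      (∀ y b σ, ∃ z : ℤ,
        fCoeff B (Q' y b) σ =
          z / 2 ^ (⌈(D : ℝ) * Real.logb 2 m + Real.logb 2 (2 / δ)⌉₊) ∧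
        |fCoeff B (Q' y b) σ| ≤ 1) ∧
      (∀ x, ∑ a, P' x a = 1) ∧ (∀ y, ∑ b, Q' y b = 1) ∧
      (∀ x a, nnorm2 (P' x a - P x a) ≤ δ / 2) ∧
      (∀ y b, nnorm2 (Q' y b - Q y b) ≤ δ / 2) := by
  have hN : 0 < 2 ^ ⌈(D : ℝ) * Real.logb 2 m + Real.logb 2 (2 / δ)⌉₊ := by positivity
  choose P' hP'h hP'c hP's hP'n using fun x =>
    exists_rounded_family hB hN (P x) (hPh x) (hPsum x) (hPc x)
  choose Q' hQ'h hQ'c hQ's hQ'n using fun y =>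
    exists_rounded_family hB hN (Q y) (hQh y) (hQsum y) (hQc y)
  push_cast at hP'c hQ'c
  exact ⟨P', Q', hP'h, hQ'h, hP'c, hQ'c, hP's, hQ's,
    fun x a => (hP'n x a).trans (pow_div_two_pow_ceil_le hδ0),
    fun y b => (hQ'n y b).trans (pow_div_two_pow_ceil_le hδ0)⟩

end
end

section
/- Let k ≥ 1 be an integer, let D be a distribution on a finite question set X, let ψ ∈ H_A ⊗ H_B be a unit vector, let {A^x_{a_1,…,a_k}} be a projective measurement on H_A for each x, and for each 1 ≤ j ≤ k let {(B_j)^x_{a_j}} be a projective measurement on H_B. Write A^x_{a_j} = ∑_{a_i, i≠j} A^x_{a_1,…,a_k} for the j-th marginal, and suppose that for each j, E_{x∼D} ∑_{a_j} ‖(A^x_{a_j} ⊗ I − I ⊗ (B_j)^x_{a_j}) ψ‖² ≤ δ. Define the POVM J^x_{a_1,…,a_k} = (B_k)^x_{a_k} ⋯ (B_2)^x_{a_2} (B_1)^x_{a_1} (B_2)^x_{a_2} ⋯ (B_k)^x_{a_k}. Then E_{x∼D} ∑_{a_1,…,a_k} ‖(A^x_{a_1,…,a_k} ⊗ I − I ⊗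 J^x_{a_1,…,a_k}) ψ‖² ≤ (2k−1)² δ. -/
open Finset Matrix ComplexOrder

noncomputable section

/-- Kronecker (tensor) product of two square matrices, on the product index type. -/
def kron {ι κ : Type} (M : Matrix ι ι ℂ) (N : Matrix κ κ ℂ) : Matrix (ι × κ) (ι × κ) ℂ :=
  fun r c => M r.1 c.1 * N r.2 c.2

/-- A POVM: a family of positive semidefinite operators summing to the identity. -/
def IsPOVM {α ι : Type} [Fintype α] [Fintype ι] [DecidableEq ι]
    (M : α → Matrix ι ι ℂ) : Prop :=
  (∀ a, (M a).PosSemidef) ∧ ∑ a, M a = 1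

/-- A projective measurement: a POVM all of whose elements are orthogonal projections. -/
def IsProjectiveMeas {α ι : Type} [Fintype α] [Fintype ι] [DecidableEq ι]
    (M : α → Matrix ι ι ℂ) : Prop :=
  IsPOVM M ∧ ∀ a, M a * M a = M a

/-- The ordered product `f_{k-1} ⋯ f_1 f_0 f_1 ⋯ f_{k-1}`. -/
def chainProd {ι : Type} [Fintype ι] [DecidableEq ι] {k : ℕ}
    (f : Fin k → Matrix ι ι ℂ) : Matrix ι ι ℂ :=
  (((List.ofFn f).drop 1).reverse.prod) * (List.ofFn f).prod

section SequentialMeasurement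

variable {X : Type*} [Fintype X]

/-- The `L²` norm of a family of vectors, averaged over questions and summed over answers. -/
def avgNorm {V ι : Type*} [NormedAddCommGroup V] [Fintype ι] (D : X → ℝ) (F : X → ι → V) : ℝ :=
  √(∑ x, D x * ∑ a, ‖F x a‖ ^ 2)

lemma avgNorm_mono {V ι ι' : Type*} [NormedAddCommGroup V] [Fintype ι] [Fintype ι'] {D : X → ℝ} (hD : ∀ x, 0 ≤ D x)
    {F : X → ι → V} {G : X → ι' → V} (h : ∀ x, ∑ a, ‖F x a‖ ^ 2 ≤ ∑ a, ‖G x a‖ ^ 2) :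
    avgNorm D F ≤ avgNorm D G :=
  Real.sqrt_le_sqrt (Finset.sum_le_sum fun x _ => mul_le_mul_of_nonneg_left (h x) (hD x))

variable {E : Type*} [NormedAddCommGroup E] [InnerProductSpace ℂ E]

lemma avgNorm_eq_norm {ι : Type*} [Fintype ι] {D : X → ℝ} (hD : ∀ x, 0 ≤ D x) (F : X → ι → E) :
    avgNorm D F =
      ‖(WithLp.toLp 2 (fun p : X × ι => ((√(D p.1) : ℝ) : ℂ) • F p.1 p.2) :
        PiLp 2 (fun _ : X × ι => E))‖ := by
  rw [PiLp.norm_eq_of_L2, avgNorm, Fintype.sum_prod_type]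
  congr 1
  refine Finset.sum_congr rfl fun x _ => ?_
  rw [Finset.mul_sum]
  refine Finset.sum_congr rfl fun a _ => ?_
  simp [norm_smul, mul_pow, Real.sq_sqrt (hD x)]

lemma avgNorm_sub_le {ι : Type*} [Fintype ι] {D : X → ℝ} (hD : ∀ x, 0 ≤ D x)
    (F G H : X → ι → E) :
    avgNorm D (fun x a => F x a - H x a) ≤
      avgNorm D (fun x a => F x a - G x a) + avgNorm D (fun x a => G x a - H x a) := by
  simp only [avgNorm_eq_norm hD]
  refine le_trans (le_of_eq ?_) (norm_add_le _ _)
  congr 1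
  ext p
  simp [← smul_add]

variable {κ : Type*} [Fintype κ] [DecidableEq κ] {α : κ → Type*}
  [∀ j, Fintype (α j)] [∀ j, DecidableEq (α j)]

/-- The marginal at coordinate `j` of a family indexed by tuples. -/
def marginal (A : (∀ j, α j) → E →L[ℂ] E) (j : κ) (b : α j) : E →L[ℂ] E :=
  ∑ a ∈ Finset.univ.filter (fun a : ∀ j', α j' => a j = b), A a

lemma norm_prod_apply_le {β : Type*} (R : β → E →L[ℂ] E) (hR : ∀ i v, ‖R i v‖ ≤ ‖v‖) (l : List β)
    (v : E) : ‖(l.map R).prod v‖ ≤ ‖v‖ := by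
  induction l with
  | nil => simp
  | cons i l ih =>
    rw [List.map_cons, List.prod_cons]
    exact (hR i _).trans ih

/-- Summing over the outcomes at the coordinates in `l`, with the others pinned to `c`. -/
lemma sum_norm_sq_prod_le (R : ∀ j, α j → E →L[ℂ] E)
    (hR : ∀ j v, ∑ b, ‖R j b v‖ ^ 2 ≤ ‖v‖ ^ 2) {l : List κ} (hl : l.Nodup) (c : ∀ j, α j) (v : E) :
    ∑ a ∈ Finset.univ.filter (fun a : ∀ j, α j => ∀ j, j ∉ l → a j = c j),
      ‖(l.map fun j => R j (a j)).prod v‖ ^ 2 ≤ ‖v‖ ^ 2 := by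
  induction l with
  | nil =>
    have : (Finset.univ.filter fun a : ∀ j, α j => ∀ j, j ∉ ([] : List κ) → a j = c j) = {c} := by
      ext a
      simp [funext_iff]
    rw [this]
    simp
  | cons i l ih =>
    obtain ⟨hi, hl⟩ := List.nodup_cons.1 hl
    refine le_trans ?_ (ih hl)
    have key : ∑ a ∈ Finset.univ.filter (fun a : ∀ j, α j => ∀ j, j ∉ i :: l → a j = c j),
        ‖((i :: l).map fun j => R j (a j)).prod v‖ ^ 2 =
        ∑ p ∈ (Finset.univ.filter (fun a : ∀ j, α j => ∀ j, j ∉ l → a j = c j)) ×ˢ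
          (Finset.univ : Finset (α i)),
          ‖R i p.2 ((l.map fun j => R j (p.1 j)).prod v)‖ ^ 2 := by
      refine Finset.sum_bij' (fun a _ => (Function.update a i (c i), a i))
        (fun p _ => Function.update p.1 i p.2) ?_ ?_ ?_ ?_ ?_
      · intro a ha
        simp only [Finset.mem_filter, Finset.mem_univ, true_and, List.mem_cons, not_or,
          Finset.mem_product, and_true] at ha ⊢
        intro j hj
        by_cases hji : j = i
        · subst hji; simp
        · simp [hji, ha j ⟨hji, hj⟩]
      · intro p hp
        simp only [Finset.mem_filter, Finset.mem_univ, true_and, List.mem_cons, not_or,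
          Finset.mem_product, and_true] at hp ⊢
        intro j hj
        simp [hj.1, hp j hj.2]
      · intro a _
        simp
      · intro p hp
        simp only [Finset.mem_filter, Finset.mem_univ, true_and, Finset.mem_product,
          and_true] at hp
        ext1 <;> simp [← hp i hi]
      · intro a _
        have : (l.map fun j => R j (Function.update a i (c i) j)) = l.map fun j => R j (a j) := by
          refine List.map_congr_left fun j hj => ?_
          rw [Function.update_of_ne (ne_of_mem_of_not_mem hj hi)]
        simp only [this, List.map_cons, List.prod_cons, mul_apply_eq_comp]
    rw [key, Finset.sum_product]
    refine Finset.sum_le_sum fun a _ => ?_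
    exact hR i ((l.map fun j => R j (a j)).prod v)

/-- Operators `T a` such that, for each outcome at coordinate `j`, those compatible with that
outcome form a sub-normalised measurement. -/
def IsSubnormalizedAt (T : (∀ j, α j) → E →L[ℂ] E) (j : κ) : Prop :=
  ∀ (b : α j) (v : E), ∑ a ∈ Finset.univ.filter (fun a : ∀ j', α j' => a j = b), ‖T a v‖ ^ 2 ≤
    ‖v‖ ^ 2

lemma IsSubnormalizedAt.sum_le {T : (∀ j, α j) → E →L[ℂ] E} {j : κ} (hT : IsSubnormalizedAt T j)
    (v : α j → E) : ∑ a, ‖T a (v (a j))‖ ^ 2 ≤ ∑ b, ‖v b‖ ^ 2 := by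
  rw [← Finset.sum_fiberwise Finset.univ (fun a : ∀ j', α j' => a j)]
  refine Finset.sum_le_sum fun b _ => le_trans (le_of_eq ?_) (hT b (v b))
  refine Finset.sum_congr rfl fun a ha => ?_
  rw [(Finset.mem_filter.1 ha).2]

lemma isSubnormalizedAt_prod (R : ∀ j, α j → E →L[ℂ] E)
    (hR : ∀ j v, ∑ b, ‖R j b v‖ ^ 2 ≤ ‖v‖ ^ 2) {l : List κ} (hl : l.Nodup) {j : κ}
    (hj : ∀ i, i ∉ l ↔ i = j) :
    IsSubnormalizedAt (fun a => (l.map fun i => R i (a i)).prod) j := fun b v => by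
  by_cases hc : ∃ c : ∀ j, α j, c j = b
  · obtain ⟨c, rfl⟩ := hc
    simpa [hj] using sum_norm_sq_prod_le R hR hl c v
  · push Not at hc
    rw [Finset.filter_false_of_mem fun c _ => hc c]
    simp

variable [CompleteSpace E]

/-- A finite family of orthogonal projections on a Hilbert space summing to the identity. -/
def IsProjResolution {ι : Type*} [Fintype ι] (T : ι → E →L[ℂ] E) : Prop :=
  (∀ a, IsStarProjection (T a)) ∧ ∑ a, T a = 1

lemma IsStarProjection.re_inner_apply {T : E →L[ℂ] E} (hT : IsStarProjection T) (v : E) :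
    (inner ℂ v (T v)).re = ‖T v‖ ^ 2 := by
  have h1 : T v = T (T v) := by
    conv_lhs => rw [← hT.isIdempotentElem.eq]
    rfl
  have h2 : inner ℂ v (T (T v)) = inner ℂ (T v) (T v) := by
    rw [← ContinuousLinearMap.adjoint_inner_left, hT.isSelfAdjoint.adjoint_eq]
  rw [h1, h2, ← h1]
  exact inner_self_eq_norm_sq (𝕜 := ℂ) (T v)

namespace IsProjResolution

variable {ι : Type*} [Fintype ι] {T : ι → E →L[ℂ] E}

lemma sum_norm_sq (hT : IsProjResolution T) (v : E) : ∑ a, ‖T a v‖ ^ 2 = ‖v‖ ^ 2 := by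
  have h : (inner ℂ v ((∑ a, T a) v)).re = ‖v‖ ^ 2 := by
    rw [hT.2]
    exact inner_self_eq_norm_sq (𝕜 := ℂ) v
  rw [← h, _root_.sum_apply, inner_sum, Complex.re_sum]
  exact Finset.sum_congr rfl fun a _ => ((hT.1 a).re_inner_apply v).symm

lemma norm_apply_le (hT : IsProjResolution T) (a : ι) (v : E) : ‖T a v‖ ≤ ‖v‖ := by
  refine (sq_le_sq₀ (norm_nonneg _) (norm_nonneg _)).1 ?_
  rw [← hT.sum_norm_sq v]
  exact Finset.single_le_sum (f := fun a => ‖T a v‖ ^ 2) (fun _ _ => sq_nonneg _)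
    (Finset.mem_univ a)

lemma mul_self (hT : IsProjResolution T) (a : ι) : T a * T a = T a :=
  (hT.1 a).isIdempotentElem.eq

lemma mul_eq_zero [DecidableEq ι] (hT : IsProjResolution T) {a b : ι} (hab : a ≠ b) :
    T a * T b = 0 := by
  ext w
  have h := hT.sum_norm_sq (T b w)
  have hb : T b (T b w) = T b w := congrArg (fun S : E →L[ℂ] E => S w) (hT.mul_self b)
  rw [← Finset.add_sum_erase _ _ (Finset.mem_univ b), hb, add_eq_left,
    Finset.sum_eq_zero_iff_of_nonneg (fun _ _ => sq_nonneg _)] at h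
  simpa using h a (by simp [hab])

end IsProjResolution

section Marginal

variable {A : (∀ j, α j) → E →L[ℂ] E}

lemma mul_marginal (hA : IsProjResolution A) (a : ∀ j, α j) (j : κ) (b : α j) :
    A a * marginal A j b = if a j = b then A a else 0 := by
  rw [marginal, Finset.mul_sum]
  have h : ∀ a', A a * A a' = if a = a' then A a else 0 := fun a' => by
    split_ifs with h
    · rw [← h, hA.mul_self]
    · exact hA.mul_eq_zero h
  simp [h]

lemma isProjResolution_marginal (hA : IsProjResolution A) (j : κ) :
    IsProjResolution (marginal A j) := by
  refine ⟨fun b => ⟨?_, ?_⟩, ?_⟩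
  · change marginal A j b * marginal A j b = _
    conv_lhs => enter [1]; rw [marginal]
    rw [Finset.sum_mul, marginal]
    refine Finset.sum_congr rfl fun a ha => ?_
    rw [← marginal, mul_marginal hA, if_pos (Finset.mem_filter.1 ha).2]
  · exact isSelfAdjoint_sum _ fun a _ => (hA.1 a).isSelfAdjoint
  · rw [← hA.2]
    exact Finset.sum_fiberwise Finset.univ (fun a : ∀ j', α j' => a j) A

lemma mul_prod_marginal (hA : IsProjResolution A) (a c : ∀ j, α j) (l : List κ) :
    A a * (l.map fun j => marginal A j (c j)).prod = if ∀ j ∈ l, a j = c j then A a else 0 := by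
  induction l with
  | nil => simp
  | cons i l ih =>
    rw [List.map_cons, List.prod_cons, ← mul_assoc, mul_marginal hA]
    by_cases h : a i = c i <;> simp [h, ih]

lemma prod_marginal (hA : IsProjResolution A) (c : ∀ j, α j) {l : List κ} (hl : ∀ j, j ∈ l) :
    (l.map fun j => marginal A j (c j)).prod = A c := by
  rw [← one_mul (List.prod _), ← hA.2, Finset.sum_mul]
  simp [mul_prod_marginal hA, hl, ← funext_iff]

end Marginal

lemma IsProjResolution.isSubnormalizedAt {A : (∀ j, α j) → E →L[ℂ] E} (hA : IsProjResolution A)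
    (j : κ) : IsSubnormalizedAt A j := fun b v => by
  rw [← hA.sum_norm_sq v]
  exact Finset.sum_le_sum_of_subset_of_nonneg (Finset.filter_subset _ _) fun _ _ _ => sq_nonneg _

section Weighted

variable {D : X → ℝ} {A : X → (∀ j, α j) → E →L[ℂ] E} {Q : ∀ j, X → α j → E →L[ℂ] E}
  {ψ : E} {ε : ℝ}

/-- Each operator of a word in the `Q`'s can be absorbed into the joint measurement `A`. -/
lemma avgNorm_prod_absorb (hD : ∀ x, 0 ≤ D x) (hA : ∀ x, IsProjResolution (A x))
    (hQ : ∀ j x, IsProjResolution (Q j x)) (hAQ : ∀ x a j b, Commute (A x a) (Q j x b))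
    (hcons : ∀ j, avgNorm D (fun x b => marginal (A x) j b ψ - Q j x b ψ) ≤ ε) (l : List κ) :
    avgNorm D (fun x a => A x a ψ - (l.map fun j => Q j x (a j)).prod (A x a ψ)) ≤
      l.length * ε := by
  induction l with
  | nil => simp [avgNorm]
  | cons i l ih =>
    refine (avgNorm_sub_le hD _ (fun x a => Q i x (a i) (A x a ψ)) _).trans ?_
    have h1 : avgNorm D (fun x a => A x a ψ - Q i x (a i) (A x a ψ)) ≤ ε := by
      refine le_trans (avgNorm_mono hD fun x => ?_) (hcons i)
      refine le_trans (le_of_eq ?_) (((hA x).isSubnormalizedAt i).sum_le _)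
      refine Finset.sum_congr rfl fun a _ => ?_
      have e1 : A x a (marginal (A x) i (a i) ψ) = A x a ψ := by
        have := mul_marginal (hA x) a i (a i)
        rw [if_pos rfl] at this
        exact congrArg (fun S : E →L[ℂ] E => S ψ) this
      have e2 : A x a (Q i x (a i) ψ) = Q i x (a i) (A x a ψ) :=
        congrArg (fun S : E →L[ℂ] E => S ψ) (hAQ x a i (a i)).eq
      rw [map_sub, e1, e2]
    have h2 : avgNorm D (fun x a => Q i x (a i) (A x a ψ) -
        ((i :: l).map fun j => Q j x (a j)).prod (A x a ψ)) ≤ l.length * ε := by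
      refine le_trans (avgNorm_mono hD fun x => Finset.sum_le_sum fun a _ => ?_) ih
      rw [List.map_cons, List.prod_cons, mul_apply_eq_comp, ← map_sub]
      gcongr
      exact (hQ i x).norm_apply_le _ _
    push_cast [List.length_cons]
    linarith

/-- In a word in the `Q`'s, a suffix can be traded for the matching product of marginals. -/
lemma avgNorm_prod_trade (hD : ∀ x, 0 ≤ D x) (hA : ∀ x, IsProjResolution (A x))
    (hQ : ∀ j x, IsProjResolution (Q j x)) (hAQ : ∀ x a j b, Commute (A x a) (Q j x b))
    (hcons : ∀ j, avgNorm D (fun x b => marginal (A x) j b ψ - Q j x b ψ) ≤ ε)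
    (s p : List κ) (hnd : (p ++ s).Nodup) (hall : ∀ j, j ∈ p ++ s) :
    avgNorm D (fun x (a : ∀ j, α j) =>
      (p.map fun j => Q j x (a j)).prod
        ((s.reverse.map fun j => marginal (A x) j (a j)).prod ψ) -
      ((p ++ s).map fun j => Q j x (a j)).prod ψ) ≤ s.length * ε := by
  induction s generalizing p with
  | nil => simp [avgNorm]
  | cons i s ih =>
    have ih' := ih (p ++ [i]) (by simpa using hnd) (by simpa using hall)
    simp only [List.append_assoc, List.singleton_append] at ih'
    refine (avgNorm_sub_le hD _ (fun x (a : ∀ j, α j) => ((p ++ [i]).map fun j => Q j x (a j)).prod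
        ((s.reverse.map fun j => marginal (A x) j (a j)).prod ψ)) _).trans ?_
    have h1 : avgNorm D (fun x (a : ∀ j, α j) => (p.map fun j => Q j x (a j)).prod
        (((i :: s).reverse.map fun j => marginal (A x) j (a j)).prod ψ) -
        ((p ++ [i]).map fun j => Q j x (a j)).prod
        ((s.reverse.map fun j => marginal (A x) j (a j)).prod ψ)) ≤ ε := by
      refine le_trans (avgNorm_mono hD fun x => ?_) (hcons i)
      have hnd' : i ∉ p ++ s ∧ (p ++ s).Nodup := by
        rw [← List.nodup_cons]
        exact (List.perm_middle.nodup_iff).1 hnd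
      have hip : i ∉ p := fun h => hnd'.1 (by simp [h])
      have his : i ∉ s := fun h => hnd'.1 (by simp [h])
      have hdis : ∀ j ∈ p, j ∉ s := fun j hp hs =>
        (List.nodup_append.1 hnd'.2).2.2 j hp j hs rfl
      have hsub := isSubnormalizedAt_prod (l := p ++ s.reverse) (j := i)
        (fun j b => if j ∈ p then Q j x b else marginal (A x) j b)
        (fun j v => by
          split_ifs
          · exact ((hQ j x).sum_norm_sq v).le
          · exact ((isProjResolution_marginal (hA x) j).sum_norm_sq v).le)
        (((List.reverse_perm s).append_left p).nodup_iff.2 hnd'.2)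
        (fun j => by
          constructor
          · intro h
            by_contra hne
            have := hall j
            simp_all
          · rintro rfl
            simp [hip, his])
      refine le_trans (le_of_eq ?_) (hsub.sum_le _)
      refine Finset.sum_congr rfl fun a _ => ?_
      have e1 : (p.map fun j => if j ∈ p then Q j x (a j) else marginal (A x) j (a j)) =
          p.map fun j => Q j x (a j) :=
        List.map_congr_left fun j hj => if_pos hj
      have e2 : (s.reverse.map fun j => if j ∈ p then Q j x (a j) else marginal (A x) j (a j)) =
          s.reverse.map fun j => marginal (A x) j (a j) :=
        List.map_congr_left fun j hj => if_neg fun h => hdis j h (List.mem_reverse.1 hj)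
      have hcomm : Commute (s.reverse.map fun j => marginal (A x) j (a j)).prod
          (Q i x (a i)) := by
        refine Commute.list_prod_left _ _ fun S hS => ?_
        obtain ⟨j, -, rfl⟩ := List.mem_map.1 hS
        exact Commute.sum_left _ _ _ fun a' _ => hAQ x a' i (a i)
      have e3 := congrArg (fun S : E →L[ℂ] E => S ψ) hcomm.eq
      simp only [mul_apply_eq_comp] at e3
      simp only [List.map_append, List.prod_append, e1, e2, mul_apply_eq_comp,
        map_sub, List.reverse_cons, List.map_cons, List.map_nil, List.prod_cons, List.prod_nil,
        mul_one, e3]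
    push_cast [List.length_cons]
    linarith

/-- If `l` lists every index once, the product of the `Q`s along `t ++ l` is consistent with `A`. -/
lemma avgNorm_sandwich_le (hD : ∀ x, 0 ≤ D x) (hA : ∀ x, IsProjResolution (A x))
    (hQ : ∀ j x, IsProjResolution (Q j x)) (hAQ : ∀ x a j b, Commute (A x a) (Q j x b))
    (hcons : ∀ j, avgNorm D (fun x b => marginal (A x) j b ψ - Q j x b ψ) ≤ ε)
    (t l : List κ) (hnd : l.Nodup) (hall : ∀ j, j ∈ l) :
    avgNorm D (fun x a => A x a ψ -
      ((t.map fun j => Q j x (a j)).prod * (l.map fun j => Q j x (a j)).prod) ψ) ≤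
      (t.length + l.length) * ε := by
  refine (avgNorm_sub_le hD _ (fun x a => (t.map fun j => Q j x (a j)).prod (A x a ψ)) _).trans ?_
  have h1 := avgNorm_prod_absorb hD hA hQ hAQ hcons t
  have h2 := avgNorm_prod_trade hD hA hQ hAQ hcons l [] (by simpa using hnd) (by simpa using hall)
  have hrev : ∀ x a, (l.reverse.map fun j => marginal (A x) j (a j)).prod = A x a := fun x a =>
    prod_marginal (hA x) a (by simpa using hall)
  simp only [List.nil_append, List.map_nil, List.prod_nil, hrev, one_apply_eq_self]
    at h2
  rw [add_mul]
  refine add_le_add h1 (le_trans (avgNorm_mono hD fun x => Finset.sum_le_sum fun a _ => ?_) h2)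
  rw [mul_apply_eq_comp, ← map_sub]
  gcongr
  exact norm_prod_apply_le _ (fun j v => (hQ j x).norm_apply_le _ v) t _

end Weighted

end SequentialMeasurement

section Matrices

open scoped Kronecker

variable {ι κ : Type} [Fintype ι] [Fintype κ] [DecidableEq ι] [DecidableEq κ]

/-- The operator `M ⊗ I` on the Euclidean space. -/
def leftOp (M : Matrix ι ι ℂ) : EuclideanSpace ℂ (ι × κ) →L[ℂ] EuclideanSpace ℂ (ι × κ) :=
  Matrix.toEuclideanCLM (n := ι × κ) (𝕜 := ℂ) (kron M 1)

/-- The operator `I ⊗ N` on the Euclidean space. -/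
def rightOp (N : Matrix κ κ ℂ) : EuclideanSpace ℂ (ι × κ) →L[ℂ] EuclideanSpace ℂ (ι × κ) :=
  Matrix.toEuclideanCLM (n := ι × κ) (𝕜 := ℂ) (kron 1 N)

omit [Fintype ι] [Fintype κ] [DecidableEq ι] [DecidableEq κ] in
lemma kron_eq_kronecker (M : Matrix ι ι ℂ) (N : Matrix κ κ ℂ) : kron M N = M ⊗ₖ N := rfl

lemma leftOp_one : leftOp (κ := κ) (1 : Matrix ι ι ℂ) = 1 := by
  rw [leftOp, kron_eq_kronecker, one_kronecker_one, map_one]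

lemma rightOp_one : rightOp (ι := ι) (1 : Matrix κ κ ℂ) = 1 := by
  rw [rightOp, kron_eq_kronecker, one_kronecker_one, map_one]

lemma leftOp_mul (M N : Matrix ι ι ℂ) : leftOp (κ := κ) (M * N) = leftOp M * leftOp N := by
  simp only [leftOp, ← map_mul, kron_eq_kronecker, ← mul_kronecker_mul, mul_one]

lemma rightOp_mul (M N : Matrix κ κ ℂ) : rightOp (ι := ι) (M * N) = rightOp M * rightOp N := by
  simp only [rightOp, ← map_mul, kron_eq_kronecker, ← mul_kronecker_mul, mul_one]

lemma leftOp_sum {β : Type*} (s : Finset β) (M : β → Matrix ι ι ℂ) :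
    leftOp (κ := κ) (∑ b ∈ s, M b) = ∑ b ∈ s, leftOp (M b) := by
  simp only [leftOp, ← map_sum]
  congr 1
  ext r c
  simp [kron, Matrix.sum_apply, Finset.sum_mul]

lemma rightOp_sum {β : Type*} (s : Finset β) (M : β → Matrix κ κ ℂ) :
    rightOp (ι := ι) (∑ b ∈ s, M b) = ∑ b ∈ s, rightOp (M b) := by
  simp only [rightOp, ← map_sum]
  congr 1
  ext r c
  simp [kron, Matrix.sum_apply, Finset.mul_sum]

lemma rightOp_list_prod (l : List (Matrix κ κ ℂ)) :
    rightOp (ι := ι) l.prod = (l.map rightOp).prod := by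
  induction l with
  | nil => exact rightOp_one
  | cons M l ih => rw [List.prod_cons, rightOp_mul, ih, List.map_cons, List.prod_cons]

lemma commute_leftOp_rightOp (M : Matrix ι ι ℂ) (N : Matrix κ κ ℂ) :
    Commute (leftOp (κ := κ) M) (rightOp N) := by
  simp only [Commute, SemiconjBy, leftOp, rightOp, ← map_mul, kron_eq_kronecker,
    ← mul_kronecker_mul, mul_one, one_mul]

lemma IsProjectiveMeas.isProjResolution_leftOp {β : Type} [Fintype β] {M : β → Matrix ι ι ℂ}
    (hM : IsProjectiveMeas M) : IsProjResolution fun b => leftOp (κ := κ) (M b) := by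
  refine ⟨fun b => ⟨?_, ?_⟩, ?_⟩
  · rw [IsIdempotentElem, ← leftOp_mul, hM.2]
  · refine IsSelfAdjoint.map ?_ _
    rw [kron_eq_kronecker, IsSelfAdjoint, star_eq_conjTranspose, conjTranspose_kronecker,
      (hM.1.1 b).isHermitian.eq, conjTranspose_one]
  · rw [← leftOp_sum, hM.1.2, leftOp_one]

lemma IsProjectiveMeas.isProjResolution_rightOp {β : Type} [Fintype β] {M : β → Matrix κ κ ℂ}
    (hM : IsProjectiveMeas M) : IsProjResolution fun b => rightOp (ι := ι) (M b) := by
  refine ⟨fun b => ⟨?_, ?_⟩, ?_⟩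
  · rw [IsIdempotentElem, ← rightOp_mul, hM.2]
  · refine IsSelfAdjoint.map ?_ _
    rw [kron_eq_kronecker, IsSelfAdjoint, star_eq_conjTranspose, conjTranspose_kronecker,
      (hM.1.1 b).isHermitian.eq, conjTranspose_one]
  · rw [← rightOp_sum, hM.1.2, rightOp_one]

lemma sum_norm_sq_kron_sub_mulVec (M : Matrix ι ι ℂ) (N : Matrix κ κ ℂ) (ψ : ι × κ → ℂ) :
    ∑ i, ‖((kron M 1 - kron 1 N).mulVec ψ) i‖ ^ 2 =
      ‖leftOp M (WithLp.toLp 2 ψ) - rightOp N (WithLp.toLp 2 ψ)‖ ^ 2 := by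
  rw [EuclideanSpace.norm_sq_eq, Matrix.sub_mulVec]
  rfl

lemma rightOp_chainProd {k : ℕ} (f : Fin k → Matrix κ κ ℂ) :
    rightOp (ι := ι) (chainProd f) =
      (((List.finRange k).drop 1).reverse.map fun j => rightOp (f j)).prod *
        ((List.finRange k).map fun j => rightOp (f j)).prod := by
  rw [chainProd, rightOp_mul, rightOp_list_prod, rightOp_list_prod, List.ofFn_eq_map]
  simp only [List.map_reverse, List.map_drop, List.map_map, Function.comp_def]

end Matrices

/-- sequential composition of consistent projective measurements. -/
theorem stmt15 (k dA dB : ℕ) (hk : 0 < k) (hdA : 0 < dA) (hdB : 0 < dB)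
    (X : Type) [Fintype X]
    (α : Fin k → Type) [∀ j, Fintype (α j)] [∀ j, DecidableEq (α j)]
    (D : X → ℝ) (hD0 : ∀ x, 0 ≤ D x) (hD1 : ∑ x : X, D x = 1)
    (A : X → (∀ j, α j) → Matrix (Fin dA) (Fin dA) ℂ)
    (hA : ∀ x, IsProjectiveMeas (A x))
    (Bm : ∀ j : Fin k, X → α j → Matrix (Fin dB) (Fin dB) ℂ)
    (hB : ∀ j x, IsProjectiveMeas (Bm j x))
    (ψ : Fin dA × Fin dB → ℂ) (hψ : ∑ i, ‖ψ i‖ ^ 2 = 1)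
    (δ : ℝ)
    (hcons : ∀ j : Fin k, ∑ x : X, D x * ∑ aj : α j, ∑ i,
      ‖((kron (∑ a ∈ Finset.univ.filter (fun a : ∀ j', α j' => a j = aj), A x a)
            (1 : Matrix (Fin dB) (Fin dB) ℂ) -
          kron (1 : Matrix (Fin dA) (Fin dA) ℂ) (Bm j x aj)).mulVec ψ) i‖ ^ 2 ≤ δ) :
    ∑ x : X, D x * ∑ a : ∀ j, α j, ∑ i,
      ‖((kron (A x a) (1 : Matrix (Fin dB) (Fin dB) ℂ) -
          kron (1 : Matrix (Fin dA) (Fin dA) ℂ)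
            (chainProd (fun j => Bm j x (a j)))).mulVec ψ) i‖ ^ 2
      ≤ (2 * (k : ℝ) - 1) ^ 2 * δ := by
  have hAr : ∀ x, IsProjResolution fun a => leftOp (κ := Fin dB) (A x a) :=
    fun x => (hA x).isProjResolution_leftOp
  have hBr : ∀ j x, IsProjResolution fun b => rightOp (ι := Fin dA) (Bm j x b) :=
    fun j x => (hB j x).isProjResolution_rightOp
  simp only [sum_norm_sq_kron_sub_mulVec, leftOp_sum] at hcons ⊢
  have hδ : 0 ≤ δ := le_trans (Finset.sum_nonneg fun x _ => mul_nonneg (hD0 x)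
    (Finset.sum_nonneg fun _ _ => sq_nonneg _)) (hcons ⟨0, hk⟩)
  have h := avgNorm_sandwich_le (ε := √δ) hD0 hAr hBr
    (fun x a j b => commute_leftOp_rightOp (A x a) (Bm j x b))
    (fun j => Real.sqrt_le_sqrt (hcons j))
    ((List.finRange k).drop 1).reverse (List.finRange k) (List.nodup_finRange k)
    (fun j => List.mem_finRange j)
  simp only [← rightOp_chainProd, List.length_reverse, List.length_drop, List.length_finRange,
    Nat.cast_pred hk] at h
  have h2 := (Real.sqrt_le_iff.1 h).2
  rw [mul_pow, Real.sq_sqrt hδ] at h2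
  refine h2.trans (le_of_eq ?_)
  ring

end
end

section
/- Let k ≥ 1 be an integer and δ, ε ∈ [0,1]. Let D be a distribution on tuples (x, y_1, …, y_k) with x in a finite set X and y_i ∈ Y_i. For each 1 ≤ i ≤ k, let G_i be a finite set of functions g_i: Y_i → R_i and, for each x, let {(G_i)^x_{g}}_{g ∈ G_i} be a projective measurement on H_B; write (G_i)^x_{[g_i(y_i)=a_i]} = ∑_{g ∈ G_i : g(y_i) = a_i} (G_i)^x_g. Assume the distance property: for every fixed z = (x, y_1, …, y_{i−1}, y_{i+1}, …, y_k) in the support of the corresponding marginal of D and every two distinct g_i, g_i' ∈ G_i, the probability over y_i drawn from the conditional distribution D_z that g_i(y_i) = g_i'(y_i) is at most ε. Let {A^{x,y_1,…,y_k}_{a_1,…,a_k}} be a projective measurement on H_A with outcomes a_i ∈ R_i (writing A^{x,y_1,…,y_k}_{a_i} for its i-th marginal), and let ψ ∈ H_A ⊗ H_B be a unit vector. Suppose that for each i: (i) E_D ∑_{a_i} ⟨ψ| A^{x,y_1,…,y_k}_{a_i} ⊗ (G_i)^x_{[g_i(y_i)=a_i]} |ψ⟩ ≥ 1 − δ, with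 the roles of the two tensor factors also satisfying the symmetric condition E_D ∑_{a_i} ⟨ψ| (G_i)^x_{[g_i(y_i)=a_i]} ⊗ A^{x,y_1,…,y_k}_{a_i} |ψ⟩ ≥ 1 − δ; and (ii) E_D ∑_{a_i} ⟨ψ| A^{x,y_1,…,y_k}_{a_i} ⊗ A^{x,y_1,…,y_k}_{a_i} |ψ⟩ ≥ 1 − δ. Define the POVM J^x_{g_1,…,g_k} = (G_k)^x_{g_k} ⋯ (G_2)^x_{g_2} (G_1)^x_{g_1} (G_2)^x_{g_2} ⋯ (G_k)^x_{g_k}. Then there exists a constant C depending only on k such that E_D ∑_{a_1,…,a_k} ‖(A^{x,y_1,…,y_k}_{a_1,…,a_k} ⊗ I − I ⊗ J^x_{[g_1(y_1),…,g_k(y_k) = a_1,…,a_k]}) ψ‖² ≤ C (δ^{1/4^k} + ε^{1/2^k}), where J^x_{[g_1(y_1),…,g_k(y_k) = a_1,…,a_k]} = ∑_{g_1,…,g_k : g_i(y_i) = a_i ∀i} J^x_{g_1,…,g_k}. -/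
open Finset Matrix ComplexOrder

noncomputable section

section PositiveFunctional

variable {𝒜 : Type*} [Ring 𝒜] [StarRing 𝒜]

/-- A finite family of self-adjoint idempotents summing to one. -/
structure IsProjFamily {ι : Type*} [Fintype ι] (U : ι → 𝒜) : Prop where
  star_eq : ∀ i, star (U i) = U i
  mul_self : ∀ i, U i * U i = U i
  sum_eq : ∑ i, U i = 1

variable {ι κ : Type*} [Fintype ι] [Fintype κ]

namespace IsProjFamily

lemma star_mul_self {U : ι → 𝒜} (hU : IsProjFamily U) (X : 𝒜) :
    ∑ i, star (U i * X) * (U i * X) = star X * X := by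
  calc ∑ i, star (U i * X) * (U i * X) = ∑ i, star X * U i * X := by
        refine sum_congr rfl fun i _ => ?_
        rw [star_mul, hU.star_eq, mul_assoc, ← mul_assoc (U i) (U i), hU.mul_self, mul_assoc]
    _ = star X * X := by rw [← Finset.sum_mul, ← Finset.mul_sum, hU.sum_eq, mul_one]

end IsProjFamily

variable [Algebra ℝ 𝒜]

/-- A real-linear functional that is hermitian and positive on squares. -/
structure IsPosFunctional (τ : 𝒜 →ₗ[ℝ] ℝ) : Prop where
  nonneg : ∀ X, 0 ≤ τ (star X * X)
  map_star : ∀ X, τ (star X) = τ X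

namespace IsPosFunctional

variable {τ : 𝒜 →ₗ[ℝ] ℝ}

lemma sum_projFamily {U : ι → 𝒜} (hU : IsProjFamily U) (X : 𝒜) :
    ∑ i, τ (star (U i * X) * (U i * X)) = τ (star X * X) := by
  rw [← map_sum, hU.star_mul_self]

lemma symm (hτ : IsPosFunctional τ) (X Y : 𝒜) : τ (star Y * X) = τ (star X * Y) := by
  rw [← hτ.map_star, star_mul, star_star]

lemma map_sub_sq (hτ : IsPosFunctional τ) (X Y : 𝒜) :
    τ (star (X - Y) * (X - Y)) =
      τ (star X * X) + τ (star Y * Y) - 2 * τ (star X * Y) := by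
  have := hτ.symm X Y
  simp only [star_sub, sub_mul, mul_sub, map_sub, this]
  ring

lemma projFamily_sum_sq (h1 : τ 1 = 1) {U : ι → 𝒜} (hU : IsProjFamily U) :
    ∑ i, τ (star (U i) * U i) = 1 := by
  simpa [h1] using sum_projFamily (τ := τ) hU 1

lemma sum_sub_sq_triangle (hτ : IsPosFunctional τ) (X Y Z : ι → 𝒜) {p q : ℝ}
    (hp : ∑ i, τ (star (X i - Y i) * (X i - Y i)) ≤ p)
    (hq : ∑ i, τ (star (Y i - Z i) * (Y i - Z i)) ≤ q) :
    ∑ i, τ (star (X i - Z i) * (X i - Z i)) ≤ 2 * p + 2 * q := by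
  have h : ∀ i, τ (star (X i - Z i) * (X i - Z i)) ≤
      2 * τ (star (X i - Y i) * (X i - Y i)) + 2 * τ (star (Y i - Z i) * (Y i - Z i)) := by
    intro i
    have h1 := hτ.nonneg ((X i - Y i) - (Y i - Z i))
    have h2 : X i - Z i = (X i - Y i) + (Y i - Z i) := by abel
    rw [h2]
    generalize X i - Y i = u at *
    generalize Y i - Z i = v at *
    simp only [star_add, star_sub, add_mul, mul_add, sub_mul, mul_sub, map_add, map_sub] at *
    linarith
  calc _ ≤ ∑ i, (2 * τ (star (X i - Y i) * (X i - Y i))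
        + 2 * τ (star (Y i - Z i) * (Y i - Z i))) := sum_le_sum fun i _ => h i
    _ ≤ _ := by rw [sum_add_distrib, ← Finset.mul_sum, ← Finset.mul_sum]; linarith

/-- Closeness of a projective family and a sub-normalised family from their correlation. -/
lemma sum_sub_sq_le (hτ : IsPosFunctional τ) (h1 : τ 1 = 1) {U V : ι → 𝒜}
    (hU : IsProjFamily U) (hV : ∑ i, τ (star (V i) * V i) ≤ 1) {δ : ℝ}
    (h : 1 - δ ≤ ∑ i, τ (U i * V i)) :
    ∑ i, τ (star (U i - V i) * (U i - V i)) ≤ 2 * δ := by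
  simp only [hτ.map_sub_sq, sum_add_distrib, sum_sub_distrib, ← Finset.mul_sum,
    projFamily_sum_sq h1 hU]
  simp only [hU.star_eq] at *
  linarith

variable [StarModule ℝ 𝒜]

lemma quadratic (hτ : IsPosFunctional τ) (X Y : 𝒜) (t : ℝ) :
    0 ≤ τ (star Y * Y) * (t * t) + 2 * τ (star X * Y) * t + τ (star X * X) := by
  have h := hτ.nonneg (X + t • Y)
  have := hτ.symm X Y
  simp only [star_add, add_mul, mul_add, map_add, star_smul, smul_mul_assoc, mul_smul_comm,
    map_smul, smul_eq_mul, this, star_trivial] at h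
  linarith

/-- Cauchy–Schwarz for finite families. -/
lemma abs_sum_le (hτ : IsPosFunctional τ) (X Y : ι → 𝒜) {p q : ℝ}
    (hp : ∑ i, τ (star (X i) * X i) ≤ p) (hq : ∑ i, τ (star (Y i) * Y i) ≤ q) :
    |∑ i, τ (star (X i) * Y i)| ≤ √p * √q := by
  have h0 : ∀ Z : ι → 𝒜, 0 ≤ ∑ i, τ (star (Z i) * Z i) :=
    fun Z => sum_nonneg fun i _ => hτ.nonneg _
  have h : ∀ t : ℝ, 0 ≤ (∑ i, τ (star (Y i) * Y i)) * (t * t) +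
      (2 * ∑ i, τ (star (X i) * Y i)) * t + ∑ i, τ (star (X i) * X i) := by
    intro t
    have := sum_nonneg fun (i : ι) (_ : i ∈ univ) => hτ.quadratic (X i) (Y i) t
    simpa only [sum_add_distrib, ← Finset.sum_mul, ← Finset.mul_sum] using this
  have hd := discrim_le_zero h
  rw [← Real.sqrt_mul ((h0 X).trans hp)]
  refine Real.abs_le_sqrt ?_
  have := mul_le_mul hp hq (h0 Y) ((h0 X).trans hp)
  unfold discrim at hd
  nlinarith

lemma abs_sum_sum_le (hτ : IsPosFunctional τ) (X Y : κ → ι → 𝒜) {p q : ℝ}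
    (hp : ∑ a, ∑ i, τ (star (X a i) * X a i) ≤ p) (hq : ∑ a, ∑ i, τ (star (Y a i) * Y a i) ≤ q) :
    |∑ a, ∑ i, τ (star (X a i) * Y a i)| ≤ √p * √q := by
  have := hτ.abs_sum_le (ι := κ × ι) (fun z => X z.1 z.2) (fun z => Y z.1 z.2) (p := p) (q := q)
    (by rwa [Fintype.sum_prod_type]) (by rwa [Fintype.sum_prod_type])
  rwa [Fintype.sum_prod_type] at this

/-- Replacing the family `A` by a close family `M` inside a correlation of two projective
families. -/
lemma abs_correlation_sub_le (hτ : IsPosFunctional τ) {U V : ι → 𝒜} {A M : κ → 𝒜} {η : ℝ}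
    (hU : IsProjFamily U) (hV : IsProjFamily V)
    (hA : ∑ a, τ (star (A a) * A a) ≤ 1) (hM : ∑ a, τ (star (M a) * M a) ≤ 1)
    (hη : ∑ a, τ (star (A a - M a) * (A a - M a)) ≤ η) :
    |∑ a, ∑ i, τ (star (U i * A a) * (V i * A a)) -
      ∑ a, ∑ i, τ (star (U i * M a) * (V i * M a))| ≤ 2 * √η := by
  have key : ∀ {W : ι → 𝒜} {B : κ → 𝒜} {p : ℝ}, IsProjFamily W →
      ∑ a, τ (star (B a) * B a) ≤ p →
      ∑ a, ∑ i, τ (star (W i * B a) * (W i * B a)) ≤ p := by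
    intro W B p hW hB
    simpa only [sum_projFamily hW] using hB
  have h1 := hτ.abs_sum_sum_le _ _ (key hU hA) (key hV hη)
  have h2 := hτ.abs_sum_sum_le _ _ (key hU hη) (key hV hM)
  have : ∑ a, ∑ i, τ (star (U i * A a) * (V i * A a)) -
      ∑ a, ∑ i, τ (star (U i * M a) * (V i * M a)) =
      ∑ a, ∑ i, τ (star (U i * A a) * (V i * (A a - M a))) +
      ∑ a, ∑ i, τ (star (U i * (A a - M a)) * (V i * M a)) := by
    simp only [← sum_add_distrib, ← sum_sub_distrib]
    refine sum_congr rfl fun a _ => sum_congr rfl fun i _ => ?_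
    simp only [mul_sub, star_sub, sub_mul, map_sub]
    ring
  rw [this]
  simp only [Real.sqrt_one, one_mul, mul_one] at h1 h2
  exact (abs_add_le _ _).trans (by linarith)

/-- One composition step: the measurement `Gr g * M a * Gr g` is consistent with the
joint measurement of `A` and `P`. -/
lemma composition_step (hτ : IsPosFunctional τ) (h1 : τ 1 = 1)
    {α β γ : Type*} [Fintype α] [Fintype β] [Fintype γ]
    {A M : α → 𝒜} {P PR Glb Grb : β → 𝒜} {Gl Gr Pg : γ → 𝒜} {δ ε η : ℝ}
    (hδ : 0 ≤ δ) (hε : 0 ≤ ε)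
    (hA : IsProjFamily A) (hP : IsProjFamily P) (hPR : IsProjFamily PR)
    (hGlb : IsProjFamily Glb) (hGrb : IsProjFamily Grb)
    (hGl : IsProjFamily Gl) (hGr : IsProjFamily Gr)
    (hPg : ∀ g, star (Pg g) = Pg g ∧ Pg g * Pg g = Pg g)
    (hMs : ∀ a, star (M a) = M a)
    (hM1 : ∀ a X, τ (star X * (M a * X)) ≤ τ (star X * X))
    (hM2 : ∀ X, ∑ a, τ (star (M a * X) * (M a * X)) ≤ τ (star X * X))
    (cAP : ∀ a b, Commute (A a) (P b)) (cAPg : ∀ a g, Commute (A a) (Pg g))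
    (cAM : ∀ a a', Commute (A a) (M a'))
    (cAGr : ∀ a g, Commute (A a) (Gr g)) (cAGrb : ∀ a b, Commute (A a) (Grb b))
    (cPM : ∀ a b, Commute (P b) (M a))
    (cPgGr : ∀ g g', Commute (Pg g) (Gr g')) (cPgM : ∀ g a, Commute (Pg g) (M a))
    (cGlM : ∀ g a, Commute (Gl g) (M a)) (cGlbM : ∀ b a, Commute (Glb b) (M a))
    (c1 : 1 - δ ≤ ∑ b, τ (P b * Grb b)) (c1' : 1 - δ ≤ ∑ g, τ (Pg g * Gr g))
    (c2 : 1 - δ ≤ ∑ b, τ (Glb b * PR b)) (c3 : 1 - δ ≤ ∑ b, τ (P b * PR b))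
    (d1 : ∑ b, τ (star (Glb b) * Grb b) ≤ ∑ g, τ (star (Gl g) * Gr g) + ε)
    (d2 : ∑ a, ∑ b, τ (star (Glb b * M a) * (Grb b * M a)) ≤
      ∑ a, ∑ g, τ (star (Gl g * M a) * (Gr g * M a)) + ε)
    (hη : ∑ a, τ (star (A a - M a) * (A a - M a)) ≤ η) :
    1 - (11 * √δ + 3 * √ε + 9 * √η + δ + ε) ≤
      ∑ a, ∑ g, τ (A a * Pg g * (Gr g * M a * Gr g)) := by
  have hMsq : ∑ a, τ (star (M a) * M a) ≤ 1 := by simpa [h1] using hM2 1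
  have hAsq := projFamily_sum_sq h1 hA
  have hPPR := hτ.sum_sub_sq_le h1 hP (projFamily_sum_sq h1 hPR).le c3
  have hPGrb := hτ.sum_sub_sq_le h1 hP (projFamily_sum_sq h1 hGrb).le c1
  have hGlbPR := hτ.sum_sub_sq_le h1 hGlb (projFamily_sum_sq h1 hPR).le c2
  have hflip : ∀ X Y : β → 𝒜, ∑ b, τ (star (X b - Y b) * (X b - Y b)) =
      ∑ b, τ (star (Y b - X b) * (Y b - X b)) := fun X Y => sum_congr rfl fun b _ => by
    rw [← neg_sub (Y b) (X b), star_neg, neg_mul_neg]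
  have hGlbP : ∑ b, τ (star (Glb b - P b) * (Glb b - P b)) ≤ 8 * δ := by
    have := hτ.sum_sub_sq_triangle Glb PR P hGlbPR ((hflip PR P).trans_le hPPR)
    linarith
  have hGlbGrb : ∑ b, τ (star (Glb b - Grb b) * (Glb b - Grb b)) ≤ 20 * δ := by
    have := hτ.sum_sub_sq_triangle Glb P Grb hGlbP hPGrb
    linarith
  have hself : ∑ g, τ (star (Gr g - Gl g) * (Gr g - Gl g)) ≤ 20 * δ + 2 * ε := by
    simp only [hτ.map_sub_sq, sum_add_distrib, sum_sub_distrib, ← Finset.mul_sum,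
      projFamily_sum_sq h1 hGlb, projFamily_sum_sq h1 hGrb, projFamily_sum_sq h1 hGl,
      projFamily_sum_sq h1 hGr] at hGlbGrb ⊢
    have : ∑ g, τ (star (Gr g) * Gl g) = ∑ g, τ (star (Gl g) * Gr g) :=
      sum_congr rfl fun g _ => hτ.symm _ _
    linarith
  -- discard `Pg`
  have e1 : ∑ a, ∑ g, τ (A a * (Gr g * M a * Gr g)) - δ ≤
      ∑ a, ∑ g, τ (A a * Pg g * (Gr g * M a * Gr g)) := by
    have hterm : ∀ a g, τ (A a * (Gr g * M a * Gr g)) - τ (A a * Pg g * (Gr g * M a * Gr g)) ≤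
        τ (A a * Gr g) - τ (A a * (Pg g * Gr g)) := by
      intro a g
      have hm := hM1 a (Gr g * ((1 - Pg g) * A a))
      have hcW : Commute (A a) (1 - Pg g) := (Commute.one_right _).sub_right (cAPg a g)
      have hcW' : Commute (1 - Pg g) (Gr g) := (Commute.one_left _).sub_left (cPgGr g g)
      have hcM : Commute (1 - Pg g) (M a) := (Commute.one_left _).sub_left (cPgM g a)
      have hW2 : (1 - Pg g) * (1 - Pg g) = 1 - Pg g := by
        simp [sub_mul, mul_sub, (hPg g).2]
      have hZ : A a * (1 - Pg g) * ((1 - Pg g) * A a) = A a * (1 - Pg g) := by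
        rw [mul_assoc, ← mul_assoc (1 - Pg g), hW2, ← hcW.eq, ← mul_assoc, hA.mul_self]
      have hZc : ∀ X, Commute (A a) X → Commute (1 - Pg g) X →
          A a * (1 - Pg g) * (X * ((1 - Pg g) * A a)) = A a * (1 - Pg g) * X := by
        intro X hX hX'
        rw [← mul_assoc X, ← hX'.eq, mul_assoc (1 - Pg g) X, ← hX.eq, ← mul_assoc (1 - Pg g),
          ← mul_assoc, hZ]
      have hs : star (Gr g * ((1 - Pg g) * A a)) = A a * (1 - Pg g) * Gr g := by
        simp [star_mul, hA.star_eq, hGr.star_eq, (hPg g).1]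
      have l1 : star (Gr g * ((1 - Pg g) * A a)) * (M a * (Gr g * ((1 - Pg g) * A a))) =
          A a * (1 - Pg g) * (Gr g * M a * Gr g) := by
        rw [hs, ← hZc (Gr g * M a * Gr g)
          (((cAGr a g).mul_right (cAM a a)).mul_right (cAGr a g))
          ((hcW'.mul_right hcM).mul_right hcW')]
        simp only [mul_assoc]
      have l2 : star (Gr g * ((1 - Pg g) * A a)) * (Gr g * ((1 - Pg g) * A a)) =
          A a * (1 - Pg g) * Gr g := by
        rw [hs, mul_assoc _ (Gr g), ← mul_assoc (Gr g), hGr.mul_self,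
          hZc (Gr g) (cAGr a g) hcW']
      rw [l1, l2] at hm
      simpa only [mul_sub, sub_mul, mul_one, map_sub, mul_assoc] using hm
    have hs := sum_le_sum fun (a : α) (_ : a ∈ univ) =>
      sum_le_sum fun (g : γ) (_ : g ∈ univ) => hterm a g
    have s1 : ∑ a, ∑ g, τ (A a * Gr g) = 1 := by
      simp only [← map_sum, ← Finset.mul_sum, hA.sum_eq, hGr.sum_eq, mul_one, h1]
    have s2 : ∑ a, ∑ g, τ (A a * (Pg g * Gr g)) = ∑ g, τ (Pg g * Gr g) := by
      rw [sum_comm]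
      simp only [← map_sum, ← Finset.sum_mul, hA.sum_eq, one_mul]
    simp only [sum_sub_distrib, s1, s2] at hs
    linarith
  -- swap the left factor `Gr`
  have e2 : |∑ a, ∑ g, τ (A a * (Gr g * M a * Gr g)) - ∑ a, ∑ g, τ (Gl g * A a * (M a * Gr g))|
      ≤ √(20 * δ + 2 * ε) := by
    have hX : ∑ a, ∑ g, τ (star (A a * (Gr g - Gl g)) * (A a * (Gr g - Gl g)))
        ≤ 20 * δ + 2 * ε := by
      rw [sum_comm]
      simpa only [sum_projFamily hA] using hself
    have hY : ∑ a, ∑ g, τ (star (M a * Gr g) * (M a * Gr g)) ≤ 1 := by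
      rw [sum_comm, ← projFamily_sum_sq h1 hGr]
      exact sum_le_sum fun g _ => hM2 (Gr g)
    have h := hτ.abs_sum_sum_le _ _ hX hY
    rw [Real.sqrt_one, mul_one] at h
    convert h using 2
    simp only [← sum_sub_distrib]
    refine sum_congr rfl fun a _ => sum_congr rfl fun g _ => ?_
    rw [← map_sub]
    congr 1
    simp only [star_mul, star_sub, hA.star_eq, hGl.star_eq, hGr.star_eq, sub_mul, ← mul_assoc,
      (cAGr a g).eq]
  have e3 : |∑ a, ∑ g, τ (Gl g * A a * (M a * Gr g)) -
      ∑ a, ∑ g, τ (star (Gl g * A a) * (Gr g * A a))| ≤ √η := by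
    have hX : ∑ a, ∑ g, τ (star (Gl g * (A a - M a)) * (Gl g * (A a - M a)))
        ≤ η := by
      simpa only [sum_projFamily hGl] using hη
    have hY : ∑ a, ∑ g, τ (star (A a * Gr g) * (A a * Gr g)) ≤ 1 := by
      rw [sum_comm, ← projFamily_sum_sq h1 hGr]
      exact sum_le_sum fun g _ => (sum_projFamily hA (Gr g)).le
    have h := hτ.abs_sum_sum_le _ _ hX hY
    rw [Real.sqrt_one, mul_one] at h
    rw [abs_sub_comm]
    convert h using 2
    simp only [← sum_sub_distrib]
    refine sum_congr rfl fun a _ => sum_congr rfl fun g _ => ?_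
    rw [← map_sub]
    congr 1
    simp only [star_mul, star_sub, hA.star_eq, hGl.star_eq, hMs, sub_mul, mul_assoc,
      (cAGr a g).eq]
    rw [← mul_assoc (M a) (Gl g), ← (cGlM g a).eq, mul_assoc, ← (cAGr a g).eq,
      ← mul_assoc (M a) (A a), ← (cAM a a).eq, mul_assoc]
  have e4 := hτ.abs_correlation_sub_le hGl hGr hAsq.le hMsq hη
  have e5 := hτ.abs_correlation_sub_le hGlb hGrb hAsq.le hMsq hη
  have e6 : |∑ a, ∑ b, τ (star (Glb b * A a) * (Grb b * A a)) -
      ∑ a, ∑ b, τ (star (Glb b * A a) * (P b * A a))| ≤ √(2 * δ) := by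
    have hX : ∑ a, ∑ b, τ (star (Glb b * A a) * (Glb b * A a)) ≤ 1 := by
      simpa only [sum_projFamily hGlb] using hAsq.le
    have hY : ∑ a, ∑ b, τ (star (A a * (Grb b - P b)) * (A a * (Grb b - P b)))
        ≤ 2 * δ := by
      rw [sum_comm]
      simpa only [sum_projFamily hA] using (hflip Grb P).trans_le hPGrb
    have h := hτ.abs_sum_sum_le _ _ hX hY
    rw [Real.sqrt_one, one_mul] at h
    convert h using 2
    simp only [← sum_sub_distrib]
    refine sum_congr rfl fun a _ => sum_congr rfl fun b _ => ?_
    rw [← map_sub, ← mul_sub, mul_sub (A a), (cAGrb a b).eq, (cAP a b).eq]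
  have e7 := hτ.abs_correlation_sub_le hGlb hP hAsq.le hMsq hη
  have e8 : |∑ a, ∑ b, τ (star (Glb b * M a) * (P b * M a)) - ∑ a, τ (star (M a) * M a)|
      ≤ √(8 * δ) := by
    have hX : ∑ a, ∑ b, τ (star (M a * (Glb b - P b)) * (M a * (Glb b - P b)))
        ≤ 8 * δ := by
      rw [sum_comm]
      exact (sum_le_sum fun b _ => hM2 (Glb b - P b)).trans hGlbP
    have hY : ∑ a, ∑ b, τ (star (P b * M a) * (P b * M a)) ≤ 1 := by
      simpa only [sum_projFamily hP] using hMsq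
    have h := hτ.abs_sum_sum_le _ _ hX hY
    rw [Real.sqrt_one, mul_one] at h
    convert h using 2
    have : ∑ a, τ (star (M a) * M a) = ∑ a, ∑ b, τ (star (P b * M a) * (P b * M a)) :=
      sum_congr rfl fun a _ => (sum_projFamily hP _).symm
    rw [this]
    simp only [← sum_sub_distrib]
    refine sum_congr rfl fun a _ => sum_congr rfl fun b _ => ?_
    rw [← map_sub, ← sub_mul, ← star_sub, mul_sub, ← (cGlbM b a).eq, ← (cPM a b).eq]
  have e9 : |1 - ∑ a, τ (star (M a) * M a)| ≤ 2 * √η := by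
    have hone : IsProjFamily (fun _ : Unit => (1 : 𝒜)) :=
      ⟨fun _ => star_one _, fun _ => one_mul _, by simp⟩
    have := hτ.abs_correlation_sub_le hone hone hAsq.le hMsq hη
    simpa [hAsq] using this
  have r1 : √(20 * δ + 2 * ε) ≤ 5 * √δ + 2 * √ε := by
    rw [Real.sqrt_le_left (by positivity)]
    nlinarith [Real.sq_sqrt hδ, Real.sq_sqrt hε, Real.sqrt_nonneg δ, Real.sqrt_nonneg ε,
      mul_nonneg (Real.sqrt_nonneg δ) (Real.sqrt_nonneg ε)]
  have r2 : √(2 * δ) ≤ 2 * √δ := by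
    rw [Real.sqrt_le_left (by positivity)]
    nlinarith [Real.sq_sqrt hδ]
  have r3 : √(8 * δ) ≤ 3 * √δ := by
    rw [Real.sqrt_le_left (by positivity)]
    nlinarith [Real.sq_sqrt hδ]
  rw [abs_le] at e2 e3 e4 e5 e6 e7 e8 e9
  have := Real.sqrt_nonneg δ
  have := Real.sqrt_nonneg ε
  linarith [e2.1, e3.1, e4.1, e5.2, e6.1, e7.1, e8.1, e9.2]

end IsPosFunctional

end PositiveFunctional

section Kron

variable {ι κ : Type}

lemma star_kron (A : Matrix ι ι ℂ) (C : Matrix κ κ ℂ) :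
    star (kron A C) = kron (star A) (star C) :=
  Matrix.conjTranspose_kronecker A C

lemma kron_one_one [DecidableEq ι] [DecidableEq κ] :
    kron (1 : Matrix ι ι ℂ) (1 : Matrix κ κ ℂ) = 1 :=
  Matrix.one_kronecker_one

lemma kron_sum_left {α : Type*} (s : Finset α) (U : α → Matrix ι ι ℂ) (C : Matrix κ κ ℂ) :
    kron (∑ a ∈ s, U a) C = ∑ a ∈ s, kron (U a) C := by
  ext r c
  simp [kron, Matrix.sum_apply, Finset.sum_mul]

lemma kron_sum_right {α : Type*} (s : Finset α) (A : Matrix ι ι ℂ) (U : α → Matrix κ κ ℂ) :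
    kron A (∑ a ∈ s, U a) = ∑ a ∈ s, kron A (U a) := by
  ext r c
  simp [kron, Matrix.sum_apply, Finset.mul_sum]

lemma kron_sub_right (A : Matrix ι ι ℂ) (C D : Matrix κ κ ℂ) :
    kron A (C - D) = kron A C - kron A D := by
  ext r c
  simp [kron, mul_sub]

variable [Fintype ι] [Fintype κ]

lemma kron_mul_kron (A B : Matrix ι ι ℂ) (C D : Matrix κ κ ℂ) :
    kron A C * kron B D = kron (A * B) (C * D) :=
  (Matrix.mul_kronecker_mul A B C D).symm

lemma posSemidef_kron {A : Matrix ι ι ℂ} {C : Matrix κ κ ℂ} (hA : A.PosSemidef)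
    (hC : C.PosSemidef) : (kron A C).PosSemidef :=
  hA.kronecker hC

end Kron

section Measurements

variable {α β γ n : Type} [Fintype α] [Fintype n] [DecidableEq n]

/-- The coarse-graining of a family of matrices along a map of outcomes. -/
def coarse [DecidableEq β] (f : α → β) (U : α → Matrix n n ℂ) (b : β) : Matrix n n ℂ :=
  ∑ a ∈ univ.filter (fun a => f a = b), U a

lemma IsPOVM.star_eq {U : α → Matrix n n ℂ} (hU : IsPOVM U) (a : α) : star (U a) = U a :=
  (hU.1 a).1

lemma IsPOVM.posSemidef_one_sub {U : α → Matrix n n ℂ} (hU : IsPOVM U) (a : α) :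
    (1 - U a).PosSemidef := by
  classical
  have : 1 - U a = ∑ c ∈ univ.erase a, U c := by
    rw [← hU.2, ← add_sum_erase univ U (mem_univ a), add_sub_cancel_left]
  rw [this]
  exact posSemidef_sum _ fun c _ => hU.1 c

lemma IsPOVM.posSemidef_sub_sq {U : α → Matrix n n ℂ} (hU : IsPOVM U) (a : α) :
    (U a - U a * U a).PosSemidef := by
  have h1 := (hU.posSemidef_one_sub a).conjTranspose_mul_mul_same (U a)
  have h2 := (hU.1 a).conjTranspose_mul_mul_same (1 - U a)
  rw [(hU.1 a).1] at h1
  rw [(hU.posSemidef_one_sub a).1] at h2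
  convert h1.add h2 using 1
  noncomm_ring

lemma IsProjectiveMeas.mul_eq_zero {U : α → Matrix n n ℂ} (hU : IsProjectiveMeas U)
    {a c : α} (hac : c ≠ a) : U c * U a = 0 := by
  classical
  have hs : ∀ c, U a * U c * U a = (U c * U a)ᴴ * (U c * U a) := by
    intro c
    rw [conjTranspose_mul, (hU.1.1 a).1, (hU.1.1 c).1, mul_assoc, mul_assoc, ← mul_assoc (U c),
      hU.2]
  have h0 : ∑ c ∈ univ.erase a, U a * U c * U a = 0 := by
    have : ∑ c, U a * U c * U a = U a := by
      rw [← Finset.sum_mul, ← Finset.mul_sum, hU.1.2, mul_one, hU.2]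
    rw [← add_sum_erase univ _ (mem_univ a), hU.2, hU.2] at this
    simpa using this
  have htr : ∑ c ∈ univ.erase a, (U a * U c * U a).trace = 0 := by
    rw [← trace_sum, h0, trace_zero]
  have hpos : ∀ c, (U a * U c * U a).PosSemidef := fun c => by
    rw [hs]; exact posSemidef_conjTranspose_mul_self _
  rw [sum_eq_zero_iff_of_nonneg fun c _ => (hpos c).trace_nonneg] at htr
  have h := (hpos c).trace_eq_zero_iff.1 (htr c (mem_erase.2 ⟨hac, mem_univ c⟩))
  rwa [hs, conjTranspose_mul_self_eq_zero] at h

lemma IsProjectiveMeas.sum_mul_sum {U : α → Matrix n n ℂ} (hU : IsProjectiveMeas U)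
    (p q : α → Prop) [DecidablePred p] [DecidablePred q] :
    (∑ a ∈ univ.filter p, U a) * ∑ a ∈ univ.filter q, U a =
      ∑ a ∈ univ.filter (fun a => p a ∧ q a), U a := by
  classical
  rw [Finset.sum_mul_sum, ← filter_filter, sum_filter (p := q)]
  refine sum_congr rfl fun a _ => ?_
  have : ∀ c, U a * U c = if a = c then U a else 0 := by
    intro c
    split_ifs with h
    · rw [← h, hU.2]
    · exact hU.mul_eq_zero h
  simp only [this, sum_ite_eq, mem_filter, mem_univ, true_and]

lemma IsProjectiveMeas.commute_coarse [DecidableEq β] [DecidableEq γ] {U : α → Matrix n n ℂ}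
    (hU : IsProjectiveMeas U) (f : α → β) (f' : α → γ) (b : β) (c : γ) :
    Commute (_root_.coarse f U b) (_root_.coarse f' U c) := by
  simp only [Commute, SemiconjBy, _root_.coarse, hU.sum_mul_sum, and_comm]

variable [Fintype β] [Fintype γ]

lemma IsProjectiveMeas.coarse [DecidableEq β] {U : α → Matrix n n ℂ} (hU : IsProjectiveMeas U)
    (f : α → β) : IsProjectiveMeas (coarse f U) := by
  refine ⟨⟨fun b => posSemidef_sum _ fun a _ => hU.1.1 a, ?_⟩, fun b => ?_⟩
  · simp only [_root_.coarse]
    rw [sum_fiberwise, hU.1.2]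
  · simp only [_root_.coarse, hU.sum_mul_sum, and_self]

/-- Measuring `G` first and then `M`, with the outcome of `G` relabelled by `v`. -/
def sandwich [DecidableEq β] (v : γ → β) (G : γ → Matrix n n ℂ) (M : α → Matrix n n ℂ)
    (z : α × β) : Matrix n n ℂ :=
  ∑ g ∈ univ.filter (fun g => v g = z.2), G g * M z.1 * G g

lemma IsPOVM.sandwich [DecidableEq β] {v : γ → β} {G : γ → Matrix n n ℂ} {M : α → Matrix n n ℂ}
    (hG : IsProjectiveMeas G) (hM : IsPOVM M) : IsPOVM (sandwich v G M) := by
  constructor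
  · refine fun z => posSemidef_sum _ fun g _ => ?_
    have := (hM.1 z.1).conjTranspose_mul_mul_same (G g)
    rwa [(hG.1.1 g).1] at this
  · rw [Fintype.sum_prod_type]
    simp only [_root_.sandwich, sum_fiberwise]
    rw [sum_comm]
    simp only [← Finset.sum_mul, ← Finset.mul_sum, hM.2, mul_one, hG.2, hG.1.2]

lemma chainProd_succ {m : ℕ} (f : Fin (m + 1) → Matrix n n ℂ)
    (hf : f (Fin.last m) * f (Fin.last m) = f (Fin.last m)) :
    chainProd f =
      f (Fin.last m) * chainProd (fun i : Fin m => f i.castSucc) * f (Fin.last m) := by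
  cases m with
  | zero => simpa [chainProd] using hf.symm
  | succ m =>
    unfold chainProd
    rw [List.ofFn_succ' f, List.concat_eq_append, List.drop_append_of_le_length (by simp)]
    simp [mul_assoc]

lemma sum_chainProd_succ {m : ℕ} {Γ : Fin (m + 1) → Type} [∀ i, Fintype (Γ i)]
    (F : ∀ i, Γ i → Matrix n n ℂ) (hF : ∀ t, F (Fin.last m) t * F (Fin.last m) t = F (Fin.last m) t)
    (p : ∀ i, Γ i → Prop) [∀ i, DecidablePred (p i)] :
    ∑ g ∈ univ.filter (fun g : ∀ i, Γ i => ∀ i, p i (g i)), chainProd (fun i => F i (g i)) =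
      ∑ t ∈ univ.filter (p (Fin.last m)), F (Fin.last m) t *
        (∑ g ∈ univ.filter (fun g : ∀ i : Fin m, Γ i.castSucc => ∀ i, p i.castSucc (g i)),
          chainProd (fun i => F i.castSucc (g i))) * F (Fin.last m) t := by
  simp only [Finset.mul_sum, Finset.sum_mul]
  rw [← sum_product', ← filter_product, univ_product_univ]
  symm
  refine sum_equiv (Fin.snocEquiv Γ) ?_ ?_
  · intro z
    simp [Fin.forall_fin_succ', Fin.snocEquiv, and_comm]
  · intro z _
    rw [chainProd_succ _ (hF _)]
    simp [Fin.snocEquiv]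

end Measurements

section State

variable {Ω N : Type} [Fintype Ω] [Fintype N]

/-- The real part of the quadratic form of a matrix at a vector. -/
def reForm (ψ : N → ℂ) : Matrix N N ℂ →ₗ[ℝ] ℝ where
  toFun Z := (star ψ ⬝ᵥ Z *ᵥ ψ).re
  map_add' Z W := by simp [add_mulVec, dotProduct_add]
  map_smul' c Z := by simp [smul_mulVec, dotProduct_smul]

/-- The state averaged over `Ω` with weights `w`. -/
def avgState (w : Ω → ℝ) (ψ : N → ℂ) : (Ω → Matrix N N ℂ) →ₗ[ℝ] ℝ where
  toFun Z := ∑ ω, w ω * reForm ψ (Z ω)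
  map_add' Z W := by simp [mul_add, sum_add_distrib]
  map_smul' c Z := by simp [Finset.mul_sum, mul_left_comm]

lemma avgState_apply (w : Ω → ℝ) (ψ : N → ℂ) (Z : Ω → Matrix N N ℂ) :
    avgState w ψ Z = ∑ ω, w ω * reForm ψ (Z ω) := rfl

lemma reForm_nonneg {ψ : N → ℂ} {Z : Matrix N N ℂ} (hZ : Z.PosSemidef) : 0 ≤ reForm ψ Z :=
  hZ.re_dotProduct_nonneg ψ

lemma reForm_star_mul_self (ψ : N → ℂ) (Z : Matrix N N ℂ) :
    reForm ψ (star Z * Z) = ∑ p, ‖(Z *ᵥ ψ) p‖ ^ 2 := by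
  change (star ψ ⬝ᵥ (star Z * Z) *ᵥ ψ).re = _
  rw [← mulVec_mulVec, star_eq_conjTranspose, dotProduct_mulVec, ← star_mulVec]
  simp [dotProduct, Complex.conj_mul', ← Complex.ofReal_pow]

lemma reForm_star (ψ : N → ℂ) (Z : Matrix N N ℂ) : reForm ψ (star Z) = reForm ψ Z := by
  change (star ψ ⬝ᵥ star Z *ᵥ ψ).re = (star ψ ⬝ᵥ Z *ᵥ ψ).re
  rw [star_eq_conjTranspose, dotProduct_mulVec, ← star_mulVec, dotProduct_comm,
    ← Complex.conj_re (star ψ ⬝ᵥ Z *ᵥ ψ)]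
  congr 1
  simp [dotProduct, mul_comm]

lemma reForm_one [DecidableEq N] {ψ : N → ℂ} (hψ : ∑ p, ‖ψ p‖ ^ 2 = 1) : reForm ψ 1 = 1 := by
  have := reForm_star_mul_self ψ 1
  simpa [hψ] using this

lemma isPosFunctional_avgState [DecidableEq N] {w : Ω → ℝ} (hw : ∀ ω, 0 ≤ w ω) (ψ : N → ℂ) :
    IsPosFunctional (avgState w ψ) where
  nonneg Z := sum_nonneg fun ω _ => mul_nonneg (hw ω)
    (reForm_nonneg (posSemidef_conjTranspose_mul_self (Z ω)))
  map_star Z := sum_congr rfl fun ω _ => by rw [Pi.star_apply, reForm_star]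

lemma avgState_mono {w : Ω → ℝ} (hw : ∀ ω, 0 ≤ w ω) {ψ : N → ℂ} {Z W : Ω → Matrix N N ℂ}
    (h : ∀ ω, (W ω - Z ω).PosSemidef) : avgState w ψ Z ≤ avgState w ψ W := by
  refine sum_le_sum fun ω _ => mul_le_mul_of_nonneg_left ?_ (hw ω)
  have := reForm_nonneg (ψ := ψ) (h ω)
  rw [map_sub] at this
  linarith

end State

section Step

variable {Ω n α β γ : Type} [Fintype n] [DecidableEq n] [Fintype α] [Fintype β] [Fintype γ]

/-- A field of matrices acting on the left tensor factor. -/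
def onLeft (Z : Ω → Matrix n n ℂ) : Ω → Matrix (n × n) (n × n) ℂ := fun ω => kron (Z ω) 1

/-- A field of matrices acting on the right tensor factor. -/
def onRight (Z : Ω → Matrix n n ℂ) : Ω → Matrix (n × n) (n × n) ℂ := fun ω => kron 1 (Z ω)

lemma commute_onLeft_onRight (Z W : Ω → Matrix n n ℂ) : Commute (onLeft Z) (onRight W) := by
  funext ω
  simp [onLeft, onRight, kron_mul_kron]

lemma isProjFamily_onLeft {U : Ω → α → Matrix n n ℂ} (hU : ∀ ω, IsProjectiveMeas (U ω)) :
    IsProjFamily (fun a => onLeft fun ω => U ω a) where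
  star_eq a := funext fun ω => by
    simp [onLeft, star_kron, (hU ω).1.star_eq]
  mul_self a := funext fun ω => by simp [onLeft, kron_mul_kron, (hU ω).2]
  sum_eq := funext fun ω => by
    simp [onLeft, ← kron_sum_left, (hU ω).1.2, kron_one_one]

lemma isProjFamily_onRight {U : Ω → α → Matrix n n ℂ} (hU : ∀ ω, IsProjectiveMeas (U ω)) :
    IsProjFamily (fun a => onRight fun ω => U ω a) where
  star_eq a := funext fun ω => by
    simp [onRight, star_kron, (hU ω).1.star_eq]
  mul_self a := funext fun ω => by simp [onRight, kron_mul_kron, (hU ω).2]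
  sum_eq := funext fun ω => by
    simp [onRight, ← kron_sum_right, (hU ω).1.2, kron_one_one]

variable [Fintype Ω]

lemma avgState_conj_onRight_le {w : Ω → ℝ} (hw : ∀ ω, 0 ≤ w ω) (ψ : n × n → ℂ)
    {M : Ω → α → Matrix n n ℂ} (hM : ∀ ω, IsPOVM (M ω)) (a : α)
    (X : Ω → Matrix (n × n) (n × n) ℂ) :
    avgState w ψ (star X * ((onRight fun ω => M ω a) * X)) ≤ avgState w ψ (star X * X) := by
  refine avgState_mono hw fun ω => ?_
  have h1 : (1 - kron 1 (M ω a) : Matrix (n × n) (n × n) ℂ) = kron 1 (1 - M ω a) := by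
    rw [kron_sub_right, kron_one_one]
  have := (posSemidef_kron (PosSemidef.one (n := n) (R := ℂ))
    ((hM ω).posSemidef_one_sub a)).conjTranspose_mul_mul_same (X ω)
  rw [← h1] at this
  convert this using 1
  simp [onRight, star_eq_conjTranspose, mul_sub, sub_mul, mul_assoc]

lemma sum_avgState_onRight_sq_le {w : Ω → ℝ} (hw : ∀ ω, 0 ≤ w ω) (ψ : n × n → ℂ)
    {M : Ω → α → Matrix n n ℂ} (hM : ∀ ω, IsPOVM (M ω)) (X : Ω → Matrix (n × n) (n × n) ℂ) :
    ∑ a, avgState w ψ (star ((onRight fun ω => M ω a) * X) * ((onRight fun ω => M ω a) * X)) ≤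
      avgState w ψ (star X * X) := by
  rw [← map_sum]
  refine avgState_mono hw fun ω => ?_
  have hpos : (∑ a, (X ω)ᴴ * kron 1 (M ω a - M ω a * M ω a) * X ω).PosSemidef :=
    posSemidef_sum _ fun a _ => (posSemidef_kron (PosSemidef.one (n := n) (R := ℂ))
      ((hM ω).posSemidef_sub_sq a)).conjTranspose_mul_mul_same (X ω)
  convert hpos using 1
  simp only [kron_sub_right, mul_sub, sub_mul, sum_sub_distrib]
  congr 1
  · rw [← Finset.sum_mul, ← Finset.mul_sum, ← kron_sum_right, (hM ω).2, kron_one_one, mul_one]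
    rfl
  · rw [Finset.sum_apply]
    refine sum_congr rfl fun a _ => ?_
    simp only [onRight, Pi.mul_apply, Pi.star_apply, star_mul, star_kron, star_one,
      (hM ω).star_eq, star_eq_conjTranspose (X ω)]
    rw [mul_assoc, ← mul_assoc (kron 1 (M ω a)), kron_mul_kron, one_mul, ← mul_assoc]

/-- Passing from agreement of evaluations to agreement of functions costs the collision
probability. -/
lemma sum_avgState_coarse_le {w : Ω → ℝ} (hw : ∀ ω, 0 ≤ w ω) (ψ : n × n → ℂ)
    [DecidableEq β] {v : Ω → γ → β} {G : Ω → γ → Matrix n n ℂ} {M : Ω → α → Matrix n n ℂ}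
    (hG : ∀ ω, IsProjectiveMeas (G ω)) (hMs : ∀ ω a, star (M ω a) = M ω a)
    {T : Ω → Ω → Prop} (hTG : ∀ ω ω', T ω ω' → G ω = G ω') (hTM : ∀ ω ω', T ω ω' → M ω = M ω')
    {ε : ℝ} (hε : 0 ≤ ε)
    (hcol : ∀ g g', g ≠ g' → ∀ F : Ω → ℝ, (∀ ω, 0 ≤ F ω) → (∀ ω ω', T ω ω' → F ω = F ω') →
      ∑ ω, w ω * (if v ω g = v ω g' then F ω else 0) ≤ ε * ∑ ω, w ω * F ω)
    (hM : ∑ a, avgState w ψ (star (onRight fun ω => M ω a) * onRight fun ω => M ω a) ≤ 1) :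
    ∑ a, ∑ b, avgState w ψ (star ((onLeft fun ω => coarse (v ω) (G ω) b) * onRight fun ω => M ω a)
        * ((onRight fun ω => coarse (v ω) (G ω) b) * onRight fun ω => M ω a)) ≤
      ∑ a, ∑ g, avgState w ψ (star ((onLeft fun ω => G ω g) * onRight fun ω => M ω a)
        * ((onRight fun ω => G ω g) * onRight fun ω => M ω a)) + ε := by
  classical
  set F : α → γ → γ → Ω → ℝ := fun a g g' ω =>
    reForm ψ (kron (G ω g) (M ω a * G ω g' * M ω a)) with hF
  have hF0 : ∀ a g g' ω, 0 ≤ F a g g' ω := by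
    intro a g g' ω
    refine reForm_nonneg (posSemidef_kron ((hG ω).1.1 g) ?_)
    have := ((hG ω).1.1 g').conjTranspose_mul_mul_same (M ω a)
    rwa [← star_eq_conjTranspose, hMs] at this
  have hFT : ∀ a g g' ω ω', T ω ω' → F a g g' ω = F a g g' ω' := by
    intro a g g' ω ω' h
    simp only [hF, hTG ω ω' h, hTM ω ω' h]
  have hprod : ∀ (U V : Ω → Matrix n n ℂ) (a : α) (ω : Ω), star (U ω) = U ω →
      (star (onLeft U * onRight fun ω => M ω a) * (onRight V * onRight fun ω => M ω a)) ω =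
        kron (U ω) (M ω a * V ω * M ω a) := by
    intro U V a ω hU
    simp [onLeft, onRight, star_kron, kron_mul_kron, hMs, hU, mul_assoc]
  have hfine : ∀ a g, avgState w ψ (star ((onLeft fun ω => G ω g) * onRight fun ω => M ω a)
        * ((onRight fun ω => G ω g) * onRight fun ω => M ω a)) = ∑ ω, w ω * F a g g ω := by
    intro a g
    refine sum_congr rfl fun ω _ => ?_
    rw [hprod _ _ _ _ ((hG ω).1.star_eq g)]
  have hcoarse : ∀ a, ∑ b, avgState w ψ
      (star ((onLeft fun ω => coarse (v ω) (G ω) b) * onRight fun ω => M ω a)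
        * ((onRight fun ω => coarse (v ω) (G ω) b) * onRight fun ω => M ω a)) =
      ∑ g, ∑ g', ∑ ω, w ω * (if v ω g = v ω g' then F a g g' ω else 0) := by
    intro a
    have hω : ∀ ω, ∑ b, reForm ψ ((star ((onLeft fun ω => coarse (v ω) (G ω) b) *
        onRight fun ω => M ω a) *
        ((onRight fun ω => coarse (v ω) (G ω) b) * onRight fun ω => M ω a)) ω) =
        ∑ g, ∑ g', (if v ω g = v ω g' then F a g g' ω else 0) := by
      intro ω
      have : ∀ b, reForm ψ ((star ((onLeft fun ω => coarse (v ω) (G ω) b) *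
        onRight fun ω => M ω a) *
        ((onRight fun ω => coarse (v ω) (G ω) b) * onRight fun ω => M ω a)) ω) =
        ∑ g ∈ univ.filter (fun g => v ω g = b), ∑ g', (if v ω g = v ω g' then F a g g' ω else 0) := by
        intro b
        rw [hprod _ _ _ _ (((hG ω).coarse (v ω)).1.star_eq b)]
        simp only [coarse, kron_sum_left, map_sum]
        refine sum_congr rfl fun g hg => ?_
        rw [← (mem_filter.1 hg).2, Finset.mul_sum, Finset.sum_mul, kron_sum_right, map_sum,
          sum_filter]
        refine sum_congr rfl fun g' _ => ?_
        simp only [eq_comm, hF]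
      simp only [this]
      exact sum_fiberwise _ _ _
    simp only [avgState_apply]
    rw [sum_comm]
    simp only [← Finset.mul_sum, hω]
    simp only [Finset.mul_sum]
    rw [sum_comm]
    exact sum_congr rfl fun g _ => sum_comm
  have htotal : ∑ a, ∑ g, ∑ g', ∑ ω, w ω * F a g g' ω ≤ 1 := by
    refine le_of_eq_of_le ?_ hM
    refine sum_congr rfl fun a _ => ?_
    rw [avgState_apply]
    have hω : ∀ ω, reForm ψ ((star (onRight fun ω => M ω a) * onRight fun ω => M ω a) ω) =
        ∑ g, ∑ g', F a g g' ω := by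
      intro ω
      simp only [hF, ← map_sum, ← kron_sum_right, ← Finset.sum_mul, ← Finset.mul_sum, (hG ω).1.2,
        ← kron_sum_left]
      simp [onRight, star_kron, kron_mul_kron, hMs]
    simp only [hω, Finset.mul_sum]
    symm
    rw [sum_comm]
    exact sum_congr rfl fun g _ => sum_comm
  have hpair : ∀ a g g', ∑ ω, w ω * (if v ω g = v ω g' then F a g g' ω else 0) ≤
      (if g = g' then ∑ ω, w ω * F a g g' ω else 0) + ε * ∑ ω, w ω * F a g g' ω := by
    intro a g g'
    split_ifs with h
    · subst h
      simp only [if_true]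
      have := mul_nonneg hε (sum_nonneg fun ω (_ : ω ∈ univ) => mul_nonneg (hw ω) (hF0 a g g ω))
      linarith
    · rw [zero_add]
      exact hcol g g' h _ (hF0 a g g') (hFT a g g')
  simp only [hcoarse, hfine]
  calc ∑ a, ∑ g, ∑ g', ∑ ω, w ω * (if v ω g = v ω g' then F a g g' ω else 0)
      ≤ ∑ a, ∑ g, ∑ g', ((if g = g' then ∑ ω, w ω * F a g g' ω else 0) +
          ε * ∑ ω, w ω * F a g g' ω) :=
        sum_le_sum fun a _ => sum_le_sum fun g _ => sum_le_sum fun g' _ => hpair a g g'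
    _ = ∑ a, ∑ g, ∑ ω, w ω * F a g g ω + ε * ∑ a, ∑ g, ∑ g', ∑ ω, w ω * F a g g' ω := by
        simp [sum_add_distrib, Finset.mul_sum]
    _ ≤ _ := by nlinarith

/-- One composition step for measurements: if `M` is close to `A` on the state, then measuring
`G` and `M` in succession is close to the joint measurement of `A` and `P`. -/
lemma sum_avgState_sandwich_le {w : Ω → ℝ} (hw : ∀ ω, 0 ≤ w ω) (hw1 : ∑ ω, w ω = 1)
    {ψ : n × n → ℂ} (hψ : ∑ p, ‖ψ p‖ ^ 2 = 1)
    [DecidableEq β] {v : Ω → γ → β} {G : Ω → γ → Matrix n n ℂ} {A M : Ω → α → Matrix n n ℂ}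
    {P : Ω → β → Matrix n n ℂ}
    (hG : ∀ ω, IsProjectiveMeas (G ω)) (hA : ∀ ω, IsProjectiveMeas (A ω))
    (hP : ∀ ω, IsProjectiveMeas (P ω)) (hAP : ∀ ω a b, Commute (A ω a) (P ω b))
    (hAP' : ∀ ω, IsProjectiveMeas (fun z : α × β => A ω z.1 * P ω z.2))
    (hM : ∀ ω, IsPOVM (M ω))
    {T : Ω → Ω → Prop} (hTG : ∀ ω ω', T ω ω' → G ω = G ω') (hTM : ∀ ω ω', T ω ω' → M ω = M ω')
    {δ ε η : ℝ} (hδ : 0 ≤ δ) (hε : 0 ≤ ε)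
    (hcol : ∀ g g', g ≠ g' → ∀ F : Ω → ℝ, (∀ ω, 0 ≤ F ω) → (∀ ω ω', T ω ω' → F ω = F ω') →
      ∑ ω, w ω * (if v ω g = v ω g' then F ω else 0) ≤ ε * ∑ ω, w ω * F ω)
    (c1 : 1 - δ ≤ ∑ ω, w ω * ∑ b, reForm ψ (kron (P ω b) (coarse (v ω) (G ω) b)))
    (c2 : 1 - δ ≤ ∑ ω, w ω * ∑ b, reForm ψ (kron (coarse (v ω) (G ω) b) (P ω b)))
    (c3 : 1 - δ ≤ ∑ ω, w ω * ∑ b, reForm ψ (kron (P ω b) (P ω b)))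
    (hη : ∑ ω, w ω * ∑ a, reForm ψ (star (kron (A ω a) 1 - kron 1 (M ω a)) *
      (kron (A ω a) 1 - kron 1 (M ω a))) ≤ η) :
    ∑ ω, w ω * ∑ z : α × β, reForm ψ
      (star (kron (A ω z.1 * P ω z.2) 1 - kron 1 (sandwich (v ω) (G ω) (M ω) z)) *
        (kron (A ω z.1 * P ω z.2) 1 - kron 1 (sandwich (v ω) (G ω) (M ω) z))) ≤
      22 * √δ + 6 * √ε + 18 * √η + 2 * δ + 2 * ε := by
  have hτ := isPosFunctional_avgState hw ψ
  have h1 : avgState w ψ 1 = 1 := by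
    simp [avgState_apply, reForm_one hψ, hw1]
  have hswap : ∀ {κ : Type} [Fintype κ] (Z : κ → Ω → Matrix (n × n) (n × n) ℂ),
      ∑ i, avgState w ψ (Z i) = ∑ ω, w ω * ∑ i, reForm ψ (Z i ω) := by
    intro κ _ Z
    simp only [avgState_apply, Finset.mul_sum]
    exact sum_comm
  have hLR : ∀ (U V : Ω → Matrix n n ℂ) ω, (onLeft U * onRight V) ω = kron (U ω) (V ω) := by
    intro U V ω
    simp [onLeft, onRight, kron_mul_kron]
  have hR1 : (onRight fun _ : Ω => (1 : Matrix n n ℂ)) = 1 := funext fun ω => kron_one_one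
  have hL := fun (U V : Ω → Matrix n n ℂ) (h : ∀ ω, Commute (U ω) (V ω)) =>
    (show Commute (onLeft U) (onLeft V) from funext fun ω => by
      simp [onLeft, kron_mul_kron, (h ω).eq])
  have hc := fun ω => (hG ω).coarse (v ω)
  have hMs : ∀ ω a, star (M ω a) = M ω a := fun ω a => (hM ω).star_eq a
  have hMsq := sum_avgState_onRight_sq_le hw ψ hM
  have hd1 := sum_avgState_coarse_le (M := fun _ (_ : Unit) => 1) hw ψ hG (by simp) hTG
    (fun _ _ _ => rfl) hε hcol (by simp [hR1, h1])
  have key := hτ.composition_step (δ := δ) (ε := ε) (η := η) h1 hδ hε (isProjFamily_onLeft hA)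
    (isProjFamily_onLeft hP)
    (isProjFamily_onRight hP) (isProjFamily_onLeft hc) (isProjFamily_onRight hc)
    (isProjFamily_onLeft hG) (isProjFamily_onRight hG)
    (Pg := fun g => onLeft fun ω => P ω (v ω g))
    (M := fun a => onRight fun ω => M ω a)
    (fun g => ⟨funext fun ω => by simp [onLeft, star_kron, (hP ω).1.star_eq],
      funext fun ω => by simp [onLeft, kron_mul_kron, (hP ω).2]⟩)
    (fun a => funext fun ω => by simp [onRight, star_kron, hMs])
    (avgState_conj_onRight_le hw ψ hM) hMsq
    (fun a b => hL _ _ fun ω => hAP ω a b) (fun a g => hL _ _ fun ω => hAP ω a _)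
    (fun _ _ => commute_onLeft_onRight _ _) (fun _ _ => commute_onLeft_onRight _ _)
    (fun _ _ => commute_onLeft_onRight _ _) (fun _ _ => commute_onLeft_onRight _ _)
    (fun _ _ => commute_onLeft_onRight _ _) (fun _ _ => commute_onLeft_onRight _ _)
    (fun _ _ => commute_onLeft_onRight _ _) (fun _ _ => commute_onLeft_onRight _ _)
    (by simpa only [hswap, hLR] using c1)
    (by
      simp only [hswap, hLR]
      refine c1.trans_eq (sum_congr rfl fun ω _ => congrArg _ ?_)
      rw [← sum_fiberwise univ (v ω)]
      refine sum_congr rfl fun b _ => ?_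
      rw [coarse, kron_sum_right, map_sum]
      exact sum_congr rfl fun g hg => by rw [(mem_filter.1 hg).2])
    (by simpa only [hswap, hLR] using c2)
    (by simpa only [hswap, hLR] using c3)
    (by simpa [hR1] using hd1)
    (sum_avgState_coarse_le hw ψ hG hMs hTG hTM hε hcol (by simpa [h1] using hMsq 1))
    (by rw [hswap]; exact hη)
  have hfin := hτ.sum_sub_sq_le (δ := 11 * √δ + 3 * √ε + 9 * √η + δ + ε) h1
    (isProjFamily_onLeft hAP')
    (V := fun z => onRight fun ω => sandwich (v ω) (G ω) (M ω) z)
    (by simpa [h1] using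
      sum_avgState_onRight_sq_le hw ψ (fun ω => IsPOVM.sandwich (v := v ω) (hG ω) (hM ω)) 1)
    (by
      refine key.trans_eq ?_
      rw [hswap, Fintype.sum_congr _ _ fun a => hswap _]
      simp only [Fintype.sum_prod_type, Finset.mul_sum]
      rw [sum_comm]
      refine sum_congr rfl fun ω _ => sum_congr rfl fun a _ => ?_
      rw [← sum_fiberwise univ (v ω)]
      refine sum_congr rfl fun b _ => ?_
      rw [hLR, sandwich, kron_sum_right, map_sum, Finset.mul_sum]
      refine sum_congr rfl fun g hg => ?_
      obtain rfl : v ω g = b := (mem_filter.1 hg).2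
      simp [onLeft, onRight, kron_mul_kron])
  rw [hswap] at hfin
  exact hfin.trans (by linarith)

end Step

section Collision

variable {κ : Type} [Fintype κ] [DecidableEq κ] {Y : κ → Type} [∀ i, Fintype (Y i)]

/-- Resampling one coordinate of a tuple counts every tuple equally often. -/
lemma sum_sum_update (i : κ) (h : (∀ j, Y j) → ℝ) :
    ∑ y, ∑ t, h (Function.update y i t) = Fintype.card (Y i) * ∑ y, h y := by
  have hinv : Function.Involutive
      (fun z : (∀ j, Y j) × Y i => (Function.update z.1 i z.2, z.1 i)) := by
    intro z
    simp
  calc ∑ y, ∑ t, h (Function.update y i t)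
      = ∑ z : (∀ j, Y j) × Y i, h (Function.update z.1 i z.2) := by rw [Fintype.sum_prod_type]
    _ = ∑ z : (∀ j, Y j) × Y i, h z.1 :=
        Fintype.sum_equiv hinv.toPerm _ _ fun z => rfl
    _ = _ := by simp [Fintype.sum_prod_type, Finset.mul_sum]

lemma sum_collision_le (i : κ) {μ F : (∀ j, Y j) → ℝ} {ε : ℝ} (c : Y i → Prop) [DecidablePred c]
    (hF : ∀ y, 0 ≤ F y) (hFi : ∀ y t, F (Function.update y i t) = F y)
    (h : ∀ y, ∑ t ∈ univ.filter c, μ (Function.update y i t) ≤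
      ε * ∑ t, μ (Function.update y i t)) :
    ∑ y, μ y * (if c (y i) then F y else 0) ≤ ε * ∑ y, μ y * F y := by
  rcases isEmpty_or_nonempty (∀ j, Y j) with hY | ⟨⟨y₀⟩⟩
  · simp
  have hcard : (0 : ℝ) < Fintype.card (Y i) := by
    exact_mod_cast Fintype.card_pos_iff.2 ⟨y₀ i⟩
  have hsum := sum_le_sum fun y (_ : y ∈ univ) => mul_le_mul_of_nonneg_left (h y) (hF y)
  have e1 := sum_sum_update i fun y => μ y * (if c (y i) then F y else 0)
  have e2 := sum_sum_update i fun y => μ y * F y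
  have l1 : ∀ y, F y * ∑ t ∈ univ.filter c, μ (Function.update y i t) =
      ∑ t, μ (Function.update y i t) *
        (if c (Function.update y i t i) then F (Function.update y i t) else 0) := by
    intro y
    rw [sum_filter, Finset.mul_sum]
    refine sum_congr rfl fun t _ => ?_
    simp only [Function.update_self, hFi]
    split_ifs <;> ring
  have l2 : ∀ y, F y * (ε * ∑ t, μ (Function.update y i t)) =
      ε * ∑ t, μ (Function.update y i t) * F (Function.update y i t) := by
    intro y
    simp only [hFi, ← Finset.sum_mul]
    ring
  simp only [l1, l2, e1, ← Finset.mul_sum, e2] at hsum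
  refine le_of_mul_le_mul_left ?_ hcard
  linarith

end Collision

lemma error_recursion {δ ε η : ℝ} (hδ : 0 ≤ δ) (hδ1 : δ ≤ 1) (hε : 0 ≤ ε) (hε1 : ε ≤ 1) (m : ℕ)
    (hη : η ≤ 400 * (δ ^ ((1 : ℝ) / 2 ^ m) + ε ^ ((1 : ℝ) / 2 ^ m))) :
    22 * √δ + 6 * √ε + 18 * √η + 2 * δ + 2 * ε ≤
      400 * (δ ^ ((1 : ℝ) / 2 ^ (m + 1)) + ε ^ ((1 : ℝ) / 2 ^ (m + 1))) := by
  have hsq : ∀ t : ℝ, 0 ≤ t →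
      t ^ ((1 : ℝ) / 2 ^ m) = (t ^ ((1 : ℝ) / 2 ^ (m + 1))) ^ 2 := by
    intro t ht
    rw [← Real.rpow_natCast (t ^ ((1 : ℝ) / 2 ^ (m + 1))) 2, ← Real.rpow_mul ht]
    congr 1
    rw [pow_succ]
    push_cast
    field_simp
  have hexp : (1 : ℝ) / 2 ^ (m + 1) ≤ 1 / 2 := by
    apply one_div_le_one_div_of_le (by norm_num)
    exact le_self_pow₀ (by norm_num) (by omega)
  have hroot : ∀ t : ℝ, 0 ≤ t → t ≤ 1 → √t ≤ t ^ ((1 : ℝ) / 2 ^ (m + 1)) := by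
    intro t ht ht1
    rcases ht.eq_or_lt with rfl | hpos
    · rw [Real.sqrt_zero]; positivity
    · rw [Real.sqrt_eq_rpow]
      exact Real.rpow_le_rpow_of_exponent_ge hpos ht1 hexp
  have hle : ∀ t : ℝ, 0 ≤ t → t ≤ 1 → t ≤ √t := fun t ht ht1 => by
    nlinarith [Real.sq_sqrt ht, Real.sqrt_nonneg t, Real.sqrt_le_one.2 ht1]
  have p := Real.rpow_nonneg hδ ((1 : ℝ) / 2 ^ (m + 1))
  have q := Real.rpow_nonneg hε ((1 : ℝ) / 2 ^ (m + 1))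
  have hη' : √η ≤ 20 * (δ ^ ((1 : ℝ) / 2 ^ (m + 1)) + ε ^ ((1 : ℝ) / 2 ^ (m + 1))) := by
    rw [Real.sqrt_le_left (by positivity)]
    rw [hsq δ hδ, hsq ε hε] at hη
    nlinarith [mul_nonneg p q]
  linarith [hroot δ hδ hδ1, hroot ε hε hε1, hle δ hδ hδ1, hle ε hε hε1]

section Prefix

variable {k d : ℕ} {X : Type} {Y R Gi : Fin k → Type}

/-- Restriction of a tuple to its first `m` coordinates. -/
def restrictTo {S : Fin k → Type} {m : ℕ} (h : m ≤ k) (a : ∀ i, S i) (i : Fin m) :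
    S (Fin.castLE h i) := a (Fin.castLE h i)

variable [∀ i, DecidableEq (R i)] [∀ i, Fintype (Gi i)]

/-- The composed measurement of the first `m` function families, evaluated at `y`. -/
def prefixComposition (gf : ∀ i, Gi i → Y i → R i)
    (G : ∀ i, X → Gi i → Matrix (Fin d) (Fin d) ℂ) {m : ℕ} (h : m ≤ k) (ω : X × ∀ i, Y i)
    (a : ∀ i : Fin m, R (Fin.castLE h i)) : Matrix (Fin d) (Fin d) ℂ :=
  ∑ g ∈ univ.filter (fun g : ∀ i : Fin m, Gi (Fin.castLE h i) =>
      ∀ i, gf (Fin.castLE h i) (g i) (ω.2 (Fin.castLE h i)) = a i),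
    chainProd (fun i => G (Fin.castLE h i) ω.1 (g i))

/-- Splitting off the last coordinate of a prefix. -/
def prefixSuccEquiv (S : Fin k → Type) {m : ℕ} (h : m + 1 ≤ k) :
    (∀ i : Fin m, S (Fin.castLE (Nat.le_of_succ_le h) i)) × S ⟨m, h⟩ ≃
      ∀ i : Fin (m + 1), S (Fin.castLE h i) :=
  (Equiv.prodComm _ _).trans (Fin.snocEquiv fun i => S (Fin.castLE h i))

lemma prefixComposition_succ (gf : ∀ i, Gi i → Y i → R i)
    {G : ∀ i, X → Gi i → Matrix (Fin d) (Fin d) ℂ} (hG : ∀ i x, IsProjectiveMeas (G i x))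
    {m : ℕ} (h : m + 1 ≤ k) (ω : X × ∀ i, Y i)
    (z : (∀ i : Fin m, R (Fin.castLE (Nat.le_of_succ_le h) i)) × R ⟨m, h⟩) :
    prefixComposition gf G h ω (prefixSuccEquiv R h z) =
      sandwich (fun g => gf ⟨m, h⟩ g (ω.2 ⟨m, h⟩)) (G ⟨m, h⟩ ω.1)
        (prefixComposition gf G (Nat.le_of_succ_le h) ω) z := by
  unfold prefixComposition
  have := sum_chainProd_succ (Γ := fun i : Fin (m + 1) => Gi (Fin.castLE h i))
    (fun i g => G (Fin.castLE h i) ω.1 g) (fun t => (hG _ _).2 t)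
    (fun i g => gf (Fin.castLE h i) g (ω.2 (Fin.castLE h i)) = prefixSuccEquiv R h z i)
  rw [this]
  have hlast : prefixSuccEquiv R h z (Fin.last m) = z.2 := by
    simp [prefixSuccEquiv, Fin.snocEquiv]
  have hinit : ∀ i : Fin m, prefixSuccEquiv R h z i.castSucc = z.1 i := fun i => by
    simp [prefixSuccEquiv, Fin.snocEquiv]
  simp only [hlast, hinit]
  rfl

variable [∀ i, Fintype (R i)]

lemma coarse_restrictTo_succ {U : (∀ i, R i) → Matrix (Fin d) (Fin d) ℂ}
    (hU : IsProjectiveMeas U) {m : ℕ} (h : m + 1 ≤ k)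
    (z : (∀ i : Fin m, R (Fin.castLE (Nat.le_of_succ_le h) i)) × R ⟨m, h⟩) :
    coarse (restrictTo h) U (prefixSuccEquiv R h z) =
      coarse (restrictTo (Nat.le_of_succ_le h)) U z.1 * coarse (fun a => a ⟨m, h⟩) U z.2 := by
  simp only [coarse, hU.sum_mul_sum]
  refine sum_congr (filter_congr fun a _ => ?_) fun _ _ => rfl
  rw [funext_iff, funext_iff, Fin.forall_fin_succ']
  have hlast : prefixSuccEquiv R h z (Fin.last m) = z.2 := by
    simp [prefixSuccEquiv, Fin.snocEquiv]
  have hinit : ∀ i : Fin m, prefixSuccEquiv R h z i.castSucc = z.1 i := fun i => by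
    simp [prefixSuccEquiv, Fin.snocEquiv]
  simp only [hlast, hinit]
  rfl

lemma isPOVM_prefixComposition (gf : ∀ i, Gi i → Y i → R i)
    {G : ∀ i, X → Gi i → Matrix (Fin d) (Fin d) ℂ} (hG : ∀ i x, IsProjectiveMeas (G i x))
    {m : ℕ} (h : m ≤ k) (ω : X × ∀ i, Y i) : IsPOVM (prefixComposition gf G h ω) := by
  induction m with
  | zero =>
    have : ∀ a, prefixComposition gf G h ω a = 1 := by
      intro a
      simp [prefixComposition, chainProd]
    exact ⟨fun a => by rw [this]; exact PosSemidef.one, by simp [this]⟩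
  | succ m ih =>
    have hs := IsPOVM.sandwich (v := fun g => gf ⟨m, h⟩ g (ω.2 ⟨m, h⟩)) (hG ⟨m, h⟩ ω.1)
      (ih (Nat.le_of_succ_le h))
    constructor
    · intro a
      obtain ⟨z, rfl⟩ := (prefixSuccEquiv R h).surjective a
      rw [prefixComposition_succ gf hG]
      exact hs.1 z
    · rw [← hs.2, ← (prefixSuccEquiv R h).sum_comp]
      exact sum_congr rfl fun z _ => prefixComposition_succ gf hG h ω z

end Prefix

section Induction

variable {k d : ℕ} {X : Type} [Fintype X] {Y R Gi : Fin k → Type} [∀ i, Fintype (Y i)]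
  [∀ i, Fintype (R i)] [∀ i, DecidableEq (R i)] [∀ i, Fintype (Gi i)]

/-- The squared distance between the first `m` marginals of `A` and the composition of the first
`m` function families is controlled by the consistency and collision errors. -/
lemma sum_prefix_le {δ ε : ℝ} (hδ : 0 ≤ δ) (hδ1 : δ ≤ 1) (hε : 0 ≤ ε) (hε1 : ε ≤ 1)
    {gf : ∀ i, Gi i → Y i → R i} {μ : X → (∀ i, Y i) → ℝ} (hμ : ∀ x y, 0 ≤ μ x y)
    (hμ1 : ∑ x, ∑ y, μ x y = 1)
    (hdist : ∀ (i : Fin k) (x : X) (y : ∀ j, Y j) (g g' : Gi i), g ≠ g' →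
      (∑ t ∈ univ.filter (fun t : Y i => gf i g t = gf i g' t), μ x (Function.update y i t)) ≤
        ε * ∑ t, μ x (Function.update y i t))
    {G : ∀ i, X → Gi i → Matrix (Fin d) (Fin d) ℂ} (hG : ∀ i x, IsProjectiveMeas (G i x))
    {A : X → (∀ i, Y i) → (∀ i, R i) → Matrix (Fin d) (Fin d) ℂ}
    (hA : ∀ x y, IsProjectiveMeas (A x y))
    {ψ : Fin d × Fin d → ℂ} (hψ : ∑ p, ‖ψ p‖ ^ 2 = 1)
    (c1 : ∀ i, 1 - δ ≤ ∑ x, ∑ y, μ x y * ∑ b, reForm ψ (kron (coarse (fun a => a i) (A x y) b)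
      (coarse (fun g => gf i g (y i)) (G i x) b)))
    (c2 : ∀ i, 1 - δ ≤ ∑ x, ∑ y, μ x y * ∑ b, reForm ψ (kron
      (coarse (fun g => gf i g (y i)) (G i x) b) (coarse (fun a => a i) (A x y) b)))
    (c3 : ∀ i, 1 - δ ≤ ∑ x, ∑ y, μ x y * ∑ b, reForm ψ (kron (coarse (fun a => a i) (A x y) b)
      (coarse (fun a => a i) (A x y) b)))
    {m : ℕ} (h : m ≤ k) :
    ∑ ω : X × ∀ i, Y i, μ ω.1 ω.2 * ∑ a, reForm ψ
      (star (kron (coarse (restrictTo h) (A ω.1 ω.2) a) 1 - kron 1 (prefixComposition gf G h ω a)) *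
        (kron (coarse (restrictTo h) (A ω.1 ω.2) a) 1 - kron 1 (prefixComposition gf G h ω a))) ≤
      400 * (δ ^ ((1 : ℝ) / 2 ^ m) + ε ^ ((1 : ℝ) / 2 ^ m)) := by
  induction m with
  | zero =>
    have h0 : ∀ (ω : X × ∀ i, Y i) a, coarse (restrictTo h) (A ω.1 ω.2) a = 1 := by
      intro ω a
      rw [← (hA ω.1 ω.2).1.2, coarse, filter_true_of_mem fun b _ => Subsingleton.elim _ _]
    have h1 : ∀ ω a, prefixComposition gf G h ω a = 1 := by
      intro ω a
      simp [prefixComposition, chainProd]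
    simp only [h0, h1, sub_self, mul_zero, map_zero, sum_const_zero]
    positivity
  | succ m ih =>
    have step := sum_avgState_sandwich_le (Ω := X × ∀ i, Y i) (w := fun ω => μ ω.1 ω.2)
      (v := fun ω g => gf ⟨m, h⟩ g (ω.2 ⟨m, h⟩)) (G := fun ω => G ⟨m, h⟩ ω.1)
      (A := fun ω => coarse (restrictTo (Nat.le_of_succ_le h)) (A ω.1 ω.2))
      (P := fun ω => coarse (fun a => a ⟨m, h⟩) (A ω.1 ω.2))
      (M := fun ω => prefixComposition gf G (Nat.le_of_succ_le h) ω)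
      (T := fun ω ω' => ω.1 = ω'.1 ∧ ∀ j, j ≠ ⟨m, h⟩ → ω.2 j = ω'.2 j)
      (fun ω => hμ _ _) (by rw [Fintype.sum_prod_type]; exact hμ1) hψ (fun ω => hG _ _)
      (fun ω => (hA _ _).coarse _) (fun ω => (hA _ _).coarse _)
      (fun ω a b => (hA _ _).commute_coarse _ _ a b)
      (fun ω => by
        convert (hA ω.1 ω.2).coarse
          (fun a => (restrictTo (Nat.le_of_succ_le h) a, a ⟨m, h⟩)) using 1
        funext z
        simp only [coarse, (hA ω.1 ω.2).sum_mul_sum, Prod.ext_iff])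
      (fun ω => isPOVM_prefixComposition gf hG _ ω)
      (fun ω ω' hT => by rw [hT.1])
      (fun ω ω' hT => by
        funext a
        have : ∀ i : Fin m, ω.2 (Fin.castLE (Nat.le_of_succ_le h) i) =
            ω'.2 (Fin.castLE (Nat.le_of_succ_le h) i) := fun i =>
          hT.2 _ fun hi => i.2.ne (congrArg Fin.val hi)
        simp only [prefixComposition, hT.1, this])
      hδ hε
      (fun g g' hg F hF hFT => by
        simp only [Fintype.sum_prod_type]
        rw [Finset.mul_sum]
        refine sum_le_sum fun x _ => ?_
        exact sum_collision_le ⟨m, h⟩ (μ := μ x) (F := fun y => F (x, y))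
          (fun t => gf ⟨m, h⟩ g t = gf ⟨m, h⟩ g' t) (fun y => hF _)
          (fun y t => hFT _ _ ⟨rfl, fun j hj => Function.update_of_ne hj _ _⟩)
          fun y => hdist _ x y g g' hg)
      (by rw [Fintype.sum_prod_type]; exact c1 _)
      (by rw [Fintype.sum_prod_type]; exact c2 _)
      (by rw [Fintype.sum_prod_type]; exact c3 _)
      (ih (Nat.le_of_succ_le h))
    refine le_trans (le_of_eq ?_)
      (step.trans (error_recursion hδ hδ1 hε hε1 m le_rfl))
    refine sum_congr rfl fun ω _ => congrArg _ ?_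
    rw [← (prefixSuccEquiv R h).sum_comp]
    refine sum_congr rfl fun z _ => ?_
    rw [prefixComposition_succ gf hG, coarse_restrictTo_succ (hA ω.1 ω.2)]

end Induction

/-- Fact 4.35 of [NW19], composition of function-evaluation
measurements: there is a constant `C = C(k)` such that under the consistency and
distance hypotheses the composed measurement `J` is close to `A`. -/
theorem stmt16 (k : ℕ) (hk : 0 < k) :
    ∃ C : ℝ, ∀ (δ ε : ℝ), 0 ≤ δ → δ ≤ 1 → 0 ≤ ε → ε ≤ 1 →
    ∀ (d : ℕ), 0 < d →
    ∀ (X : Type) (_ : Fintype X)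
      (Y : Fin k → Type) (_ : ∀ i, Fintype (Y i)) (_ : ∀ i, DecidableEq (Y i))
      (R : Fin k → Type) (_ : ∀ i, Fintype (R i)) (_ : ∀ i, DecidableEq (R i))
      (Gi : Fin k → Type) (_ : ∀ i, Fintype (Gi i)) (_ : ∀ i, DecidableEq (Gi i))
      (gf : ∀ i, Gi i → Y i → R i), (∀ i, Function.Injective (gf i)) →
    ∀ (μ : X → (∀ i, Y i) → ℝ), (∀ x y, 0 ≤ μ x y) →
      (∑ x : X, ∑ y : ∀ i, Y i, μ x y = 1) →
    -- the distance property of the function families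
    (∀ (i : Fin k) (x : X) (y : ∀ j, Y j) (g g' : Gi i), g ≠ g' →
      (∑ yi ∈ Finset.univ.filter (fun yi : Y i => gf i g yi = gf i g' yi),
          μ x (Function.update y i yi))
        ≤ ε * ∑ yi : Y i, μ x (Function.update y i yi)) →
    ∀ (G : ∀ i : Fin k, X → Gi i → Matrix (Fin d) (Fin d) ℂ),
      (∀ i x, IsProjectiveMeas (G i x)) →
    ∀ (A : X → (∀ i, Y i) → (∀ i, R i) → Matrix (Fin d) (Fin d) ℂ),
      (∀ x y, IsProjectiveMeas (A x y)) →
    ∀ (ψ : Fin d × Fin d → ℂ), (∑ p, ‖ψ p‖ ^ 2 = 1) →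
    -- consistency between the marginals of A and the G measurements, both ways
    (∀ i : Fin k, 1 - δ ≤ ∑ x : X, ∑ y : ∀ j, Y j, μ x y * ∑ ai : R i,
      (star ψ ⬝ᵥ (kron
          (∑ a ∈ Finset.univ.filter (fun a : ∀ j, R j => a i = ai), A x y a)
          (∑ g ∈ Finset.univ.filter (fun g : Gi i => gf i g (y i) = ai), G i x g)).mulVec
        ψ).re) →
    (∀ i : Fin k, 1 - δ ≤ ∑ x : X, ∑ y : ∀ j, Y j, μ x y * ∑ ai : R i,
      (star ψ ⬝ᵥ (kron
          (∑ g ∈ Finset.univ.filter (fun g : Gi i => gf i g (y i) = ai), G i x g)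
          (∑ a ∈ Finset.univ.filter (fun a : ∀ j, R j => a i = ai), A x y a)).mulVec
        ψ).re) →
    -- self-consistency of A
    (∀ i : Fin k, 1 - δ ≤ ∑ x : X, ∑ y : ∀ j, Y j, μ x y * ∑ ai : R i,
      (star ψ ⬝ᵥ (kron
          (∑ a ∈ Finset.univ.filter (fun a : ∀ j, R j => a i = ai), A x y a)
          (∑ a ∈ Finset.univ.filter (fun a : ∀ j, R j => a i = ai), A x y a)).mulVec
        ψ).re) →
    -- conclusion
    ∑ x : X, ∑ y : ∀ j, Y j, μ x y * ∑ a : ∀ i, R i, ∑ p,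
        ‖((kron (A x y a) (1 : Matrix (Fin d) (Fin d) ℂ) -
            kron (1 : Matrix (Fin d) (Fin d) ℂ)
              (∑ g ∈ Finset.univ.filter
                  (fun g : ∀ i, Gi i => ∀ i, gf i (g i) (y i) = a i),
                chainProd (fun i => G i x (g i)))).mulVec ψ) p‖ ^ 2
      ≤ C * (δ ^ ((1 : ℝ) / 4 ^ k) + ε ^ ((1 : ℝ) / 2 ^ k)) := by
  refine ⟨400, ?_⟩
  intro δ ε hδ hδ1 hε hε1 d _ X _ Y _ _ R _ _ Gi _ _ gf _ μ hμ hμ1 hdist G hG A hA ψ hψ c1 c2 c3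
  have key := sum_prefix_le hδ hδ1 hε hε1 hμ hμ1 hdist hG hA hψ c1 c2 c3 (le_refl k)
  have hcoarse : ∀ x y a, coarse (restrictTo (le_refl k)) (A x y) a = A x y a := by
    intro x y a
    have : univ.filter (fun b : ∀ i, R i => restrictTo (le_refl k) b = a) = {a} := by
      ext b
      simp only [mem_filter, mem_univ, true_and, mem_singleton]
      exact Iff.rfl
    rw [coarse, this, sum_singleton]
  have hexp : δ ^ ((1 : ℝ) / 2 ^ k) ≤ δ ^ ((1 : ℝ) / 4 ^ k) := by
    refine Real.rpow_le_rpow_of_exponent_ge' hδ hδ1 (by positivity) ?_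
    gcongr
    norm_num
  rw [Fintype.sum_prod_type] at key
  refine le_trans (le_of_eq ?_) (key.trans (by linarith))
  refine sum_congr rfl fun x _ => sum_congr rfl fun y _ => congrArg _ ?_
  refine sum_congr rfl fun a _ => ?_
  rw [reForm_star_mul_self, hcoarse x y a]
  rfl

end
end
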